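/- arXiv:2007.08717 — 12 statements merged into one kernel-verified Lean document; each statement's English description precedes it below -/
import Mathlib

section
/- Let d ≥ 1 and let P be a finite set of n points in ℝ^d. Then there exists a partition of P into r = ⌈n/(d+1)⌉ pairwise disjoint subsets P_1, …, P_r such that the intersection ⋂_{i=1}^r conv(P_i) of their convex hulls is nonempty. -/
/-- The point of a convex set closest to the origin satisfies the variational inequality. -/
theorem Convex.sq_norm_le_inner_of_forall_norm_le {E : Type*} [NormedAddCommGroup E]
    [InnerProductSpace ℝ E] {s : Set E} (hs : Convex ℝ s) {x : E} (hx : x ∈ s)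
    (hmin : ∀ y ∈ s, ‖x‖ ≤ ‖y‖) {y : E} (hy : y ∈ s) : ‖x‖ ^ 2 ≤ inner ℝ x y := by
  have : Nonempty s := ⟨⟨x, hx⟩⟩
  have hinf : ‖(0 : E) - x‖ = ⨅ w : s, ‖(0 : E) - w‖ := by
    simp only [zero_sub, norm_neg]
    refine le_antisymm (le_ciInf fun w => hmin w w.2) ?_
    exact ciInf_le (f := fun w : s => ‖(w : E)‖)
      ⟨0, by rintro _ ⟨w, rfl⟩; exact norm_nonneg _⟩ ⟨x, hx⟩
  have h := (norm_eq_iInf_iff_real_inner_le_zero hs hx).1 hinf y hy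
  rw [zero_sub, inner_neg_left, inner_sub_right, real_inner_self_eq_norm_sq] at h
  linarith

/-- An affinely independent family contained in a hyperplane which avoids the origin is
linearly independent. -/
theorem AffineIndependent.linearIndependent_of_inner_eq {E ι : Type*} [NormedAddCommGroup E]
    [InnerProductSpace ℝ E] {z : ι → E} (hz : AffineIndependent ℝ z) {x : E} {c : ℝ}
    (hc : c ≠ 0) (h : ∀ i, inner ℝ x (z i) = c) : LinearIndependent ℝ z := by
  rw [linearIndependent_iff']
  intro s g hg
  refine affineIndependent_iff.1 hz s g ?_ hg
  have h0 : inner ℝ x (∑ i ∈ s, g i • z i) = 0 := by rw [hg, inner_zero_right]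
  simp only [inner_sum, inner_smul_right, h, ← Finset.sum_mul] at h0
  exact (mul_eq_zero.1 h0).resolve_right hc

/-- **Colorful Carathéodory theorem.** If the origin lies in the convex hull of each of more than
`dim E` color classes, then it lies in the convex hull of some choice of one point per class. -/
theorem exists_zero_mem_convexHull_range_choice {E ι κ : Type*} [NormedAddCommGroup E]
    [InnerProductSpace ℝ E] [FiniteDimensional ℝ E] [Fintype ι] [Finite κ] (c : ι → κ → E)
    (hcard : Module.finrank ℝ E < Fintype.card ι)
    (h0 : ∀ i, (0 : E) ∈ convexHull ℝ (Set.range (c i))) :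
    ∃ j : ι → κ, (0 : E) ∈ convexHull ℝ (Set.range fun i => c i (j i)) := by
  classical
  have : Nonempty ι := Fintype.card_pos_iff.1 (by lia)
  have hκ : Nonempty κ := by
    have hne : (convexHull ℝ (Set.range (c (Classical.arbitrary ι)))).Nonempty := ⟨0, h0 _⟩
    exact Set.range_nonempty_iff_nonempty.1 (convexHull_nonempty_iff.1 hne)
  let H : (ι → κ) → Set E := fun j => convexHull ℝ (Set.range fun i => c i (j i))
  have hcomp : IsCompact (⋃ j, H j) :=
    isCompact_iUnion fun j => (Set.finite_range _).isCompact_convexHull ℝ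
  have hne : (⋃ j, H j).Nonempty := by
    obtain ⟨a⟩ := hκ
    exact ⟨c (Classical.arbitrary ι) a, Set.mem_iUnion.2
      ⟨fun _ => a, subset_convexHull ℝ _ ⟨Classical.arbitrary ι, rfl⟩⟩⟩
  obtain ⟨x, hx, hmin⟩ := hcomp.exists_isMinOn hne continuous_norm.continuousOn
  have hinner : ∀ j, x ∈ H j → ∀ y ∈ H j, ‖x‖ ^ 2 ≤ inner ℝ x y := fun j hxj y hy =>
    (convex_convexHull ℝ _).sq_norm_le_inner_of_forall_norm_le hxj
      (fun w hw => hmin (Set.mem_iUnion.2 ⟨j, hw⟩)) hy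
  obtain ⟨j, hj⟩ := Set.mem_iUnion.1 hx
  by_cases hx0 : x = 0
  · exact ⟨j, hx0 ▸ hj⟩
  exfalso
  have hpos : 0 < ‖x‖ ^ 2 := by positivity
  obtain ⟨σ, _, z, w, hzr, hz, hw, hw1, hwx⟩ := eq_pos_convex_span_of_mem_convexHull hj
  have hle : ∀ s, ‖x‖ ^ 2 ≤ inner ℝ x (z s) := fun s =>
    hinner j hj _ (subset_convexHull ℝ _ (hzr ⟨s, rfl⟩))
  have heq : ∀ s, inner ℝ x (z s) = ‖x‖ ^ 2 := by
    have hsum : ∑ s, w s * (inner ℝ x (z s) - ‖x‖ ^ 2) = 0 := by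
      have h1 : ∑ s, w s * inner ℝ x (z s) = ‖x‖ ^ 2 := by
        have hxx : inner ℝ x (∑ s, w s • z s) = ‖x‖ ^ 2 := by
          rw [hwx, real_inner_self_eq_norm_sq]
        simpa only [inner_sum, inner_smul_right] using hxx
      simp only [mul_sub, Finset.sum_sub_distrib, ← Finset.sum_mul, hw1, h1, one_mul, sub_self]
    intro s
    have hs := (Finset.sum_eq_zero_iff_of_nonneg fun s _ =>
      mul_nonneg (hw s).le (sub_nonneg.2 (hle s))).1 hsum s (Finset.mem_univ s)
    exact sub_eq_zero.1 ((mul_eq_zero.1 hs).resolve_left (hw s).ne')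
  have hσ := (hz.linearIndependent_of_inner_eq hpos.ne' heq).fintype_card_le_finrank
  choose f hf using fun s => hzr ⟨s, rfl⟩
  obtain ⟨p, hp⟩ : ∃ p, p ∉ Set.range f := by
    by_contra! hall
    have := Fintype.card_le_of_surjective f hall
    lia
  obtain ⟨a, ha⟩ : ∃ a, inner ℝ x (c p a) ≤ 0 := by
    by_contra! hall
    have hsub : convexHull ℝ (Set.range (c p)) ⊆ {y | 0 < inner ℝ x y} := by
      refine convexHull_min (by rintro _ ⟨a, rfl⟩; exact hall a) ?_
      exact convex_halfSpace_gt (innerSL ℝ x).toLinearMap.isLinear 0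
    simpa using hsub (h0 p)
  have hxj' : x ∈ H (Function.update j p a) := by
    rw [← hwx]
    refine (convex_convexHull ℝ _).sum_mem (fun s _ => (hw s).le) hw1 fun s _ =>
      subset_convexHull ℝ _ ⟨f s, ?_⟩
    have hne : f s ≠ p := fun h => hp ⟨s, h⟩
    simpa [Function.update_of_ne hne] using hf s
  have := hinner _ hxj' (c p a) (subset_convexHull ℝ _ ⟨p, by simp⟩)
  linarith

/-- **Tverberg's theorem** for indexed families: any `k * (d + 1) + 1` points in `ℝ^d` can be
colored with `k + 1` colors so that the convex hulls of the color classes share a point. -/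
theorem exists_coloring_forall_mem_convexHull {ι : Type*} [Fintype ι] {d k : ℕ}
    (p : ι → EuclideanSpace ℝ (Fin d)) (hcard : k * (d + 1) < Fintype.card ι) :
    ∃ (j : ι → Fin (k + 1)) (y : EuclideanSpace ℝ (Fin d)),
      ∀ i, y ∈ convexHull ℝ (p '' {a | j a = i}) := by
  classical
  let q : ι → Option (Fin d) → ℝ := fun a o => o.elim 1 (p a)
  let c : ι → Fin (k + 1) → EuclideanSpace ℝ (Fin k × Option (Fin d)) := fun a i =>
    WithLp.toLp 2 fun m =>
      ((if i = m.1.castSucc then 1 else 0) - (if i = Fin.last k then 1 else 0)) * q a m.2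
  have h0 : ∀ a, (0 : EuclideanSpace ℝ (Fin k × Option (Fin d))) ∈
      convexHull ℝ (Set.range (c a)) := by
    intro a
    have hsum : ∑ i, ((k : ℝ) + 1)⁻¹ • c a i = 0 := by
      rw [← Finset.smul_sum]
      ext m
      simp [c, ← Finset.sum_mul, Finset.sum_sub_distrib]
    rw [← hsum]
    refine (convex_convexHull ℝ _).sum_mem (fun _ _ => by positivity) ?_
      fun i _ => subset_convexHull ℝ _ ⟨i, rfl⟩
    simp [mul_inv_cancel₀ (by positivity : (k : ℝ) + 1 ≠ 0)]
  obtain ⟨j, hj⟩ := exists_zero_mem_convexHull_range_choice c (by simpa using hcard) h0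
  rw [convexHull_range_eq_exists_affineCombination] at hj
  obtain ⟨s, w, hw, hw1, hws⟩ := hj
  rw [s.affineCombination_eq_linear_combination _ _ hw1] at hws
  let S : Fin (k + 1) → Option (Fin d) → ℝ := fun i o => ∑ a ∈ s with j a = i, w a * q a o
  have hS : ∀ i o, S i o = S (Fin.last k) o := by
    intro i o
    induction i using Fin.lastCases with
    | last => rfl
    | cast i =>
      have h := congrArg (fun v : EuclideanSpace ℝ (Fin k × Option (Fin d)) => v (i, o)) hws
      simp only [c, WithLp.ofLp_sum, WithLp.ofLp_smul, Finset.sum_apply, Pi.smul_apply,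
        smul_eq_mul, PiLp.zero_apply] at h
      rw [← sub_eq_zero, ← h]
      simp only [S, Finset.sum_filter, ← Finset.sum_sub_distrib]
      refine Finset.sum_congr rfl fun a _ => ?_
      split_ifs <;> ring
  have hlast : ((k : ℝ) + 1) * S (Fin.last k) none = 1 := by
    have h : ∑ i, S i none = 1 := by
      rw [← hw1, ← Finset.sum_fiberwise s j w]
      simp [S, q]
    simpa [hS] using h
  refine ⟨j, WithLp.toLp 2 fun t => ((k : ℝ) + 1) * S (Fin.last k) (some t), fun i => ?_⟩
  have hy : WithLp.toLp 2 (fun t => ((k : ℝ) + 1) * S (Fin.last k) (some t)) =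
      ∑ a ∈ s with j a = i, (((k : ℝ) + 1) * w a) • p a := by
    ext t
    simp [← hS i, S, q, Finset.mul_sum, mul_assoc]
  rw [hy]
  refine (convex_convexHull ℝ _).sum_mem (fun a ha => ?_) ?_ fun a ha =>
    subset_convexHull ℝ _ ⟨a, (Finset.mem_filter.1 ha).2, rfl⟩
  · exact mul_nonneg (by positivity) (hw a (Finset.mem_filter.1 ha).1)
  · rw [← hS i] at hlast
    simpa [S, q, Finset.mul_sum] using hlast


/-- **Tverberg's theorem.** Any set `P` of `n` points in `ℝ^d` (`d ≥ 1`) can be partitioned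
into `r = ⌈n/(d+1)⌉` pairwise disjoint subsets whose convex hulls have a common point.
Here `⌈n/(d+1)⌉ = (n + d) / (d + 1)` in natural-number arithmetic. -/
theorem tverberg (d n : ℕ) (hd : 1 ≤ d)
    (P : Finset (EuclideanSpace ℝ (Fin d))) (hP : P.card = n) :
    ∃ Q : Fin ((n + d) / (d + 1)) → Finset (EuclideanSpace ℝ (Fin d)),
      (∀ i, Q i ⊆ P) ∧
      (∀ i j, i ≠ j → Disjoint (Q i) (Q j)) ∧
      (⋃ i, (Q i : Set (EuclideanSpace ℝ (Fin d)))) = (P : Set (EuclideanSpace ℝ (Fin d))) ∧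
      (⋂ i, convexHull ℝ (Q i : Set (EuclideanSpace ℝ (Fin d)))).Nonempty := by
  classical
  have hdiv := Nat.div_mul_le_self (n + d) (d + 1)
  have hlt := Nat.lt_div_mul_add (a := n + d) (b := d + 1) (by lia)
  generalize (n + d) / (d + 1) = r at hdiv hlt ⊢
  obtain _ | k := r
  · have hP0 : P = ∅ := Finset.card_eq_zero.1 (by lia)
    exact ⟨fun _ => ∅, by simp [hP0]⟩
  obtain ⟨j, y, hy⟩ := exists_coloring_forall_mem_convexHull (k := k)
    (fun a : P => (a : EuclideanSpace ℝ (Fin d)))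
    (by rw [Fintype.card_coe, hP]; rw [Nat.add_mul] at hdiv; lia)
  have hQ : ∀ i, (((Finset.univ.filter fun a => j a = i).map (Function.Embedding.subtype _) :
      Finset (EuclideanSpace ℝ (Fin d))) : Set (EuclideanSpace ℝ (Fin d))) =
      (fun a : P => (a : EuclideanSpace ℝ (Fin d))) '' {a | j a = i} := fun i => by ext; simp
  refine ⟨fun i => (Finset.univ.filter fun a => j a = i).map (Function.Embedding.subtype _),
    fun i v hv => ?_, fun i i' hi => ?_, ?_, y, Set.mem_iInter.2 fun i => ?_⟩
  · obtain ⟨a, -, rfl⟩ := Finset.mem_map.1 hv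
    exact a.2
  · rw [Finset.disjoint_map, Finset.disjoint_filter]
    rintro a - rfl h
    exact hi h
  · ext v
    simp
  · rw [hQ]
    exact hy i
end

section
/- Let d ≥ 1, let P be a finite set in ℝ^d, let q ∈ ℝ^d with q ∉ P, and let S ⊆ P be a subset with |S| ≤ d+1 and q ∈ conv(S). Then the Tukey depth of q with respect to P \ S is at least the Tukey depth of q with respect to P, minus d. -/
open scoped RealInnerProductSpace

/-- The Tukey depth of a point `q` with respect to a set `P ⊆ ℝ^d`: the minimum number of
points of `P` contained in a closed halfspace containing `q`. -/
noncomputable def tukeyDepth {d : ℕ} (P : Set (EuclideanSpace ℝ (Fin d)))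
    (q : EuclideanSpace ℝ (Fin d)) : ℕ :=
  sInf { m : ℕ | ∃ (v : EuclideanSpace ℝ (Fin d)) (c : ℝ),
    v ≠ 0 ∧ ⟪v, q⟫ ≤ c ∧ (P ∩ {x | ⟪v, x⟫ ≤ c}).ncard = m }

/-- A point of `convexHull ℝ S` does not have strictly larger inner product with `v` than
every point of `S`. -/
theorem exists_inner_le_of_mem_convexHull {E : Type*} [NormedAddCommGroup E]
    [InnerProductSpace ℝ E] {S : Set E} {q : E} (hq : q ∈ convexHull ℝ S) (v : E) :
    ∃ s ∈ S, ⟪v, q⟫ ≤ ⟪v, s⟫ := by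
  by_contra! h
  have hsub : convexHull ℝ S ⊆ {x | ⟪v, x⟫ < ⟪v, q⟫} :=
    convexHull_min h (convex_halfSpace_lt (innerₛₗ ℝ v).isLinear _)
  exact lt_irrefl ⟪v, q⟫ (hsub hq)

/-- A halfspace with `q` on its boundary can be rotated about `q` so as to exclude a given point
`s ≠ q` outside its interior, without gaining any point of a finite set `P`. -/
theorem exists_halfspace_not_mem {E : Type*} [NormedAddCommGroup E] [InnerProductSpace ℝ E]
    {P : Set E} (hP : P.Finite) {q s v : E} (hsq : s ≠ q) (hs : ⟪v, q⟫ ≤ ⟪v, s⟫) :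
    ∃ w : E, ⟪w, q⟫ < ⟪w, s⟫ ∧ ∀ p ∈ P, ⟪w, p⟫ ≤ ⟪w, q⟫ → ⟪v, p⟫ ≤ ⟪v, q⟫ := by
  have hev : ∀ p ∈ P, ∀ᶠ ε in nhdsWithin (0 : ℝ) (Set.Ioi 0),
      ⟪v + ε • (s - q), p⟫ ≤ ⟪v + ε • (s - q), q⟫ → ⟪v, p⟫ ≤ ⟪v, q⟫ := by
    intro p _
    rcases le_or_gt ⟪v, p⟫ ⟪v, q⟫ with h | h
    · exact Filter.Eventually.of_forall fun _ _ => h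
    · have hlt : ∀ᶠ ε in nhds (0 : ℝ), ⟪v + ε • (s - q), q⟫ < ⟪v + ε • (s - q), p⟫ := by
        apply ContinuousAt.eventually_lt
        · fun_prop
        · fun_prop
        · simpa using h
      filter_upwards [nhdsWithin_le_nhds hlt] with ε hε hle
      exact absurd hε hle.not_gt
  obtain ⟨ε, hε, hpos⟩ :=
    (((Filter.eventually_all_finite hP).2 hev).and self_mem_nhdsWithin).exists
  refine ⟨v + ε • (s - q), ?_, hε⟩
  have hsq' : 0 < ⟪s - q, s - q⟫ := real_inner_self_pos.2 (sub_ne_zero.2 hsq)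
  rw [← sub_pos, ← inner_sub_right, inner_add_left, real_inner_smul_left, inner_sub_right v]
  have := mul_pos (Set.mem_Ioi.1 hpos) hsq'
  linarith

/-- Removing from `P` a subset `S` of at most `d + 1` points whose convex hull contains
`q ∉ P` decreases the Tukey depth of `q` by at most `d`. -/
theorem tukeyDepth_sdiff_simplex (d : ℕ) (hd : 1 ≤ d)
    (P : Set (EuclideanSpace ℝ (Fin d))) (hPfin : P.Finite)
    (q : EuclideanSpace ℝ (Fin d)) (hq : q ∉ P)
    (S : Set (EuclideanSpace ℝ (Fin d))) (hSP : S ⊆ P) (hScard : S.ncard ≤ d + 1)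
    (hqS : q ∈ convexHull ℝ S) :
    tukeyDepth P q - d ≤ tukeyDepth (P \ S) q := by
  have : Nonempty (Fin d) := ⟨⟨0, hd⟩⟩
  obtain ⟨v₀, hv₀⟩ := exists_ne (0 : EuclideanSpace ℝ (Fin d))
  obtain ⟨v, c, -, hqc, hcard⟩ := Nat.sInf_mem
    (s := { m : ℕ | ∃ (v : EuclideanSpace ℝ (Fin d)) (c : ℝ),
      v ≠ 0 ∧ ⟪v, q⟫ ≤ c ∧ ((P \ S) ∩ {x | ⟪v, x⟫ ≤ c}).ncard = m })
    ⟨_, v₀, ⟪v₀, q⟫, hv₀, le_rfl, rfl⟩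
  obtain ⟨s, hsS, hs⟩ := exists_inner_le_of_mem_convexHull hqS v
  obtain ⟨w, hws, hwP⟩ :=
    exists_halfspace_not_mem hPfin (ne_of_mem_of_not_mem (hSP hsS) hq) hs
  have hw : w ≠ 0 := by
    rintro rfl
    simp at hws
  have hdepth : tukeyDepth P q ≤ (P ∩ {x | ⟪w, x⟫ ≤ ⟪w, q⟫}).ncard :=
    Nat.sInf_le ⟨w, _, hw, le_rfl, rfl⟩
  have hsub : P ∩ {x | ⟪w, x⟫ ≤ ⟪w, q⟫} ⊆ ((P \ S) ∩ {x | ⟪v, x⟫ ≤ c}) ∪ (S \ {s}) := by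
    rintro x ⟨hxP, hx⟩
    by_cases hxS : x ∈ S
    · refine Or.inr ⟨hxS, ?_⟩
      rintro rfl
      exact hws.not_ge hx
    · exact Or.inl ⟨⟨hxP, hxS⟩, (hwP x hxP hx).trans hqc⟩
  have hSfin : S.Finite := hPfin.subset hSP
  have hle := Set.ncard_le_ncard hsub ((hPfin.sdiff.inter_of_left _).union hSfin.sdiff)
  have hunion := Set.ncard_union_le ((P \ S) ∩ {x | ⟪v, x⟫ ≤ c}) (S \ {s})
  have hS := Set.ncard_sdiff_singleton_add_one hsS hSfin
  change _ = tukeyDepth (P \ S) q at hcard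
  omega
end

section
/- Let d ≥ 1, let P be a finite set in ℝ^d, and let q ∈ ℝ^d with q ∉ P have Tukey depth k ≥ 1 with respect to P. Then there exist ⌈k/d⌉ pairwise disjoint subsets of P, each of size at most d+1, such that the convex hull of each subset contains q. -/
open scoped RealInnerProductSpace

section TukeyDepth

variable {E : Type*} [NormedAddCommGroup E] [InnerProductSpace ℝ E]

/-- If an affinely independent family of `finrank + 1` points lies in a closed halfspace whose
boundary contains a positive convex combination of the family, then the normal vector vanishes. -/
theorem AffineIndependent.eq_zero_of_inner_le [FiniteDimensional ℝ E] {ι : Type*} [Fintype ι]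
    {z : ι → E} (hz : AffineIndependent ℝ z)
    (hcard : Fintype.card ι = Module.finrank ℝ E + 1) {w : ι → ℝ} (hw : ∀ i, 0 < w i)
    (hw1 : ∑ i, w i = 1) {q v : E} (hq : ∑ i, w i • z i = q)
    (hv : ∀ i, ⟪v, z i⟫ ≤ ⟪v, q⟫) : v = 0 := by
  have hsum : ∑ i, w i * (⟪v, q⟫ - ⟪v, z i⟫) = 0 := by
    have h : ⟪v, q⟫ = ∑ i, w i * ⟪v, z i⟫ := by
      rw [← hq, inner_sum]
      exact Finset.sum_congr rfl fun i _ ↦ real_inner_smul_right _ _ _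
    simp only [mul_sub, Finset.sum_sub_distrib]
    rw [← Finset.sum_mul, hw1, ← h, one_mul, sub_self]
  have heq (i : ι) : ⟪v, z i⟫ = ⟪v, q⟫ := by
    have h := (Finset.sum_eq_zero_iff_of_nonneg fun i _ ↦
      mul_nonneg (hw i).le (sub_nonneg.2 (hv i))).1 hsum i (Finset.mem_univ i)
    have h' := (mul_eq_zero.1 h).resolve_left (hw i).ne'
    linarith
  have htop := hz.vectorSpan_eq_top_of_card_eq_finrank_add_one hcard
  have hle : vectorSpan ℝ (Set.range z) ≤ (ℝ ∙ v)ᗮ := by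
    rw [vectorSpan_def, Submodule.span_le]
    rintro _ ⟨_, ⟨i, rfl⟩, _, ⟨j, rfl⟩, rfl⟩
    simp [Submodule.mem_orthogonal_singleton_iff_inner_right, inner_sub_right, heq]
  have hmem : v ∈ (ℝ ∙ v)ᗮ := hle (htop ▸ Submodule.mem_top)
  exact inner_self_eq_zero.1 (Submodule.mem_orthogonal_singleton_iff_inner_right.1 hmem)

/-- A form of Carathéodory's theorem in which every closed halfspace with `q` on its boundary
contains at most `finrank` of the chosen points. -/
theorem exists_subset_mem_convexHull_card_inner_le [FiniteDimensional ℝ E] {P : Finset E} {q : E}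
    (hq : q ∈ convexHull ℝ (P : Set E)) :
    ∃ Q ⊆ P, Q.card ≤ Module.finrank ℝ E + 1 ∧ q ∈ convexHull ℝ (Q : Set E) ∧
      ∀ v : E, v ≠ 0 → {x ∈ Q | ⟪v, x⟫ ≤ ⟪v, q⟫}.card ≤ Module.finrank ℝ E := by
  classical
  obtain ⟨ι, _, z, w, hzP, hz, hw, hw1, hzq⟩ := eq_pos_convex_span_of_mem_convexHull hq
  have hι : Fintype.card ι ≤ Module.finrank ℝ E + 1 :=
    hz.card_le_finrank_succ.trans (Nat.succ_le_succ (Submodule.finrank_le _))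
  have himage : (Finset.univ.image z).card ≤ Fintype.card ι := Finset.card_image_le
  refine ⟨Finset.univ.image z, ?_, himage.trans hι, ?_, fun v hv ↦ ?_⟩
  · intro x hx
    obtain ⟨i, -, rfl⟩ := Finset.mem_image.1 hx
    exact hzP ⟨i, rfl⟩
  · rw [← hzq]
    exact (convex_convexHull ℝ _).sum_mem (fun i _ ↦ (hw i).le) hw1
      fun i _ ↦ subset_convexHull ℝ _ (by simp)
  · by_contra! hlt
    have hfilter : {x ∈ Finset.univ.image z | ⟪v, x⟫ ≤ ⟪v, q⟫} = Finset.univ.image z :=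
      Finset.eq_of_subset_of_card_le (Finset.filter_subset _ _) (by omega)
    rw [hfilter] at hlt
    refine hv (hz.eq_zero_of_inner_le (by omega) hw hw1 hzq fun i ↦ ?_)
    exact Finset.filter_eq_self.1 hfilter (z i) (Finset.mem_image_of_mem z (Finset.mem_univ i))

/-- If every closed halfspace with `q` on its boundary meets `P`, then `q` lies in the convex hull
of `P`. -/
theorem mem_convexHull_of_exists_inner_le [CompleteSpace E] [Nontrivial E] {P : Finset E} {q : E}
    (h : ∀ v : E, v ≠ 0 → ∃ x ∈ P, ⟪v, x⟫ ≤ ⟪v, q⟫) : q ∈ convexHull ℝ (P : Set E) := by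
  by_contra hq
  obtain ⟨f, u, hfq, hfP⟩ := geometric_hahn_banach_point_closed (convex_convexHull ℝ (P : Set E))
    (P.finite_toSet.isClosed_convexHull ℝ) hq
  have hlt {x : E} (hx : x ∈ P) : f q < f x := hfq.trans (hfP x (subset_convexHull ℝ _ hx))
  have hinner (x : E) : ⟪(InnerProductSpace.toDual ℝ E).symm f, x⟫ = f x := by simp
  obtain ⟨v, hv⟩ := exists_ne (0 : E)
  obtain ⟨x, hx, -⟩ := h v hv
  obtain ⟨y, hy, hle⟩ := h ((InnerProductSpace.toDual ℝ E).symm f) fun h0 ↦ by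
    have := hlt hx
    simp [← hinner, h0] at this
  rw [hinner, hinner] at hle
  exact (hlt hy).not_ge hle

/-- If every closed halfspace with `q` on its boundary contains at least `n` points of `P`, then
`P` has `r` disjoint subsets of Carathéodory size whose convex hulls contain `q`, as soon as
`finrank * r < n + finrank`. -/
theorem exists_disjoint_mem_convexHull [FiniteDimensional ℝ E] [Nontrivial E] {q : E} (r n : ℕ)
    (P : Finset E) (hP : ∀ v : E, v ≠ 0 → n ≤ {x ∈ P | ⟪v, x⟫ ≤ ⟪v, q⟫}.card)
    (hr : Module.finrank ℝ E * r < n + Module.finrank ℝ E) :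
    ∃ Q : Fin r → Finset E, (∀ i, Q i ⊆ P) ∧ (∀ i, (Q i).card ≤ Module.finrank ℝ E + 1) ∧
      (∀ i j, i ≠ j → Disjoint (Q i) (Q j)) ∧ ∀ i, q ∈ convexHull ℝ (Q i : Set E) := by
  classical
  induction r generalizing n P with
  | zero => exact ⟨Fin.elim0, fun i ↦ i.elim0, fun i ↦ i.elim0, fun i ↦ i.elim0, fun i ↦ i.elim0⟩
  | succ r ih =>
    rw [mul_add_one, add_lt_add_iff_right] at hr
    have : CompleteSpace E := FiniteDimensional.complete ℝ E
    have hq : q ∈ convexHull ℝ (P : Set E) := mem_convexHull_of_exists_inner_le fun v hv ↦ by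
      obtain ⟨x, hx⟩ := Finset.card_pos.1 (hr.pos.trans_le (hP v hv))
      exact ⟨x, (Finset.mem_filter.1 hx).1, (Finset.mem_filter.1 hx).2⟩
    obtain ⟨Q₀, hQ₀P, hcard₀, hq₀, hQ₀⟩ := exists_subset_mem_convexHull_card_inner_le hq
    obtain ⟨Q, hQP, hcard, hdisj, hqQ⟩ := ih (n - Module.finrank ℝ E) (P \ Q₀)
      (fun v hv ↦ by
        have h : {x ∈ P \ Q₀ | ⟪v, x⟫ ≤ ⟪v, q⟫} =
            {x ∈ P | ⟪v, x⟫ ≤ ⟪v, q⟫} \ {x ∈ Q₀ | ⟪v, x⟫ ≤ ⟪v, q⟫} := by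
          ext x
          simp only [Finset.mem_filter, Finset.mem_sdiff]
          tauto
        rw [h]
        exact (tsub_le_tsub (hP v hv) (hQ₀ v hv)).trans (Finset.le_card_sdiff _ _))
      (by omega)
    have hdisj₀ (i : Fin r) : Disjoint Q₀ (Q i) :=
      Finset.disjoint_sdiff.mono_right (hQP i)
    refine ⟨Fin.cons Q₀ Q, Fin.cases hQ₀P fun i ↦ (hQP i).trans Finset.sdiff_subset,
      Fin.cases hcard₀ hcard, ?_, Fin.cases hq₀ hqQ⟩
    intro i j hij
    cases i using Fin.cases <;> cases j using Fin.cases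
    · exact absurd rfl hij
    · exact hdisj₀ _
    · exact (hdisj₀ _).symm
    · exact hdisj _ _ fun h ↦ hij (congrArg Fin.succ h)

end TukeyDepth

/-- A closed halfspace with `q` on its boundary contains at least `tukeyDepth P q` points. -/
theorem tukeyDepth_le_card_inner_le {d : ℕ} (P : Finset (EuclideanSpace ℝ (Fin d)))
    (q : EuclideanSpace ℝ (Fin d)) {v : EuclideanSpace ℝ (Fin d)} (hv : v ≠ 0) :
    tukeyDepth (P : Set (EuclideanSpace ℝ (Fin d))) q ≤ {x ∈ P | ⟪v, x⟫ ≤ ⟪v, q⟫}.card := by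
  refine Nat.sInf_le ⟨v, ⟪v, q⟫, hv, le_rfl, ?_⟩
  rw [← Set.ncard_coe_finset, Finset.coe_filter]
  rfl

/-- If `q ∉ P` has Tukey depth `k ≥ 1` with respect to a finite set `P ⊆ ℝ^d`, then there
are `⌈k/d⌉ = (k + d - 1) / d` pairwise disjoint subsets of `P`, each of at most `d + 1`
points, whose convex hulls all contain `q`. -/
theorem tverberg_from_tukey (d k : ℕ) (hd : 1 ≤ d) (hk : 1 ≤ k)
    (P : Finset (EuclideanSpace ℝ (Fin d)))
    (q : EuclideanSpace ℝ (Fin d)) (hq : q ∉ P)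
    (hdepth : tukeyDepth (P : Set (EuclideanSpace ℝ (Fin d))) q = k) :
    ∃ Q : Fin ((k + d - 1) / d) → Finset (EuclideanSpace ℝ (Fin d)),
      (∀ i, Q i ⊆ P) ∧
      (∀ i, (Q i).card ≤ d + 1) ∧
      (∀ i j, i ≠ j → Disjoint (Q i) (Q j)) ∧
      ∀ i, q ∈ convexHull ℝ (Q i : Set (EuclideanSpace ℝ (Fin d))) := by
  have : NeZero d := ⟨by omega⟩
  have hmul := Nat.mul_div_le (k + d - 1) d
  simpa only [finrank_euclideanSpace_fin] using
    exists_disjoint_mem_convexHull ((k + d - 1) / d) k P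
      (fun v hv ↦ hdepth ▸ tukeyDepth_le_card_inner_le P q hv)
      (by rw [finrank_euclideanSpace_fin]; omega)
end

section
/- Let P be a finite set of n points in ℝ^d partitioned into pairwise disjoint subsets P_1, …, P_k such that for every i, every closed halfspace H of ℝ^d with |P ∩ H| ≥ n/(d+1) contains at least one point of P_i (i.e., each P_i is a (1/(d+1))-net for P with respect to closed halfspaces). Then ⋂_{i=1}^k conv(P_i) ≠ ∅; indeed, every point of Tukey depth at least n/(d+1) with respect to P lies in conv(P_i) for every i. -/
open scoped RealInnerProductSpace

/-- A point belongs to the convex hull of a finite set `S` as soon as every closed halfspace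
with the point on its boundary meets `S`. -/
theorem mem_convexHull_of_forall_halfspace {E : Type*} [NormedAddCommGroup E]
    [InnerProductSpace ℝ E] [CompleteSpace E] [Nontrivial E] (S : Finset E) (q : E)
    (h : ∀ v : E, v ≠ 0 → ∃ s ∈ S, ⟪v, s⟫ ≤ ⟪v, q⟫) : q ∈ convexHull ℝ (S : Set E) := by
  by_contra hq
  obtain ⟨w, hw⟩ := exists_ne (0 : E)
  obtain ⟨b, hb, -⟩ := h w hw
  obtain ⟨f, u, hfq, hf⟩ := geometric_hahn_banach_point_closed (convex_convexHull ℝ (S : Set E))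
    (S.finite_toSet.isClosed_convexHull ℝ) hq
  have hfS : ∀ s ∈ S, f q < f s := fun s hs =>
    hfq.trans (hf s (subset_convexHull ℝ _ (Finset.mem_coe.2 hs)))
  obtain ⟨v, rfl⟩ := (InnerProductSpace.toDual ℝ E).surjective f
  simp only [InnerProductSpace.toDual_apply_apply] at hfS
  have hv : v ≠ 0 := by
    rintro rfl
    simpa using hfS b hb
  obtain ⟨s, hs, hsq⟩ := h v hv
  exact (hfS s hs).not_ge hsq

/-- If at most `m` subsets of a nonempty finite set `P` each miss fewer than `#P / m` points
of `P`, then they have a common point in `P`. -/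
theorem exists_mem_forall_mem_of_card_sdiff_lt {α : Type*} [DecidableEq α] {P : Finset α}
    (hP : P.Nonempty) {m : ℕ} {I : Finset (Finset α)} (hI : I.card ≤ m)
    (h : ∀ S ∈ I, m * (P \ S).card < P.card) : ∃ p ∈ P, ∀ S ∈ I, p ∈ S := by
  by_contra! hne
  have hcover : P ⊆ I.biUnion (P \ ·) := fun p hp => by
    obtain ⟨S, hS, hpS⟩ := hne p hp
    exact Finset.mem_biUnion.2 ⟨S, hS, Finset.mem_sdiff.2 ⟨hp, hpS⟩⟩
  have hI0 : I.Nonempty := by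
    obtain ⟨p, hp⟩ := hP
    obtain ⟨S, hS, -⟩ := hne p hp
    exact ⟨S, hS⟩
  have hlt : m * P.card < m * P.card := calc
    m * P.card ≤ m * ∑ S ∈ I, (P \ S).card :=
      Nat.mul_le_mul_left m ((Finset.card_le_card hcover).trans Finset.card_biUnion_le)
    _ = ∑ S ∈ I, m * (P \ S).card := Finset.mul_sum ..
    _ < ∑ _S ∈ I, P.card := Finset.sum_lt_sum_of_nonempty hI0 h
    _ = I.card * P.card := by simp
    _ ≤ m * P.card := Nat.mul_le_mul_right _ hI
  exact hlt.false

/-- **Centerpoint theorem**: every finite set `P` in a `d`-dimensional space admits a point of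
Tukey depth at least `#P / (d + 1)`. -/
theorem exists_centerpoint {E : Type*} [NormedAddCommGroup E] [InnerProductSpace ℝ E]
    [FiniteDimensional ℝ E] (P : Finset E) :
    ∃ q : E, ∀ (v : E) (c : ℝ), ⟪v, q⟫ ≤ c →
      (P.card : ℝ) / (Module.finrank ℝ E + 1) ≤ (((P : Set E) ∩ {x | ⟪v, x⟫ ≤ c}).ncard : ℝ) := by
  classical
  rcases P.eq_empty_or_nonempty with rfl | hP
  · exact ⟨0, by simp⟩
  let F := P.powerset.filter fun S => (Module.finrank ℝ E + 1) * (P \ S).card < P.card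
  obtain ⟨q, hq⟩ : (⋂ S ∈ F, convexHull ℝ (S : Set E)).Nonempty := by
    refine Convex.helly_theorem' (𝕜 := ℝ) (fun S _ => convex_convexHull ℝ _) fun I hIF hI => ?_
    obtain ⟨p, -, hp⟩ := exists_mem_forall_mem_of_card_sdiff_lt hP hI
      fun S hS => (Finset.mem_filter.1 (hIF hS)).2
    exact ⟨p, Set.mem_iInter₂.2 fun S hS => subset_convexHull ℝ _ (hp S hS)⟩
  refine ⟨q, fun v c hqc => ?_⟩
  by_contra! hlt
  have hH : (P : Set E) ∩ {x | ⟪v, x⟫ ≤ c} = (P.filter fun x => ⟪v, x⟫ ≤ c : Finset E) := by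
    ext; simp
  rw [hH, Set.ncard_coe_finset, lt_div_iff₀ (by positivity), mul_comm] at hlt
  have hmem : P.filter (fun x => ¬ ⟪v, x⟫ ≤ c) ∈ F := by
    refine Finset.mem_filter.2 ⟨Finset.mem_powerset.2 (Finset.filter_subset _ _), ?_⟩
    rw [Finset.filter_not, Finset.sdiff_sdiff_eq_self (Finset.filter_subset _ _)]
    exact_mod_cast hlt
  have hconv : Convex ℝ {x : E | c < ⟪v, x⟫} :=
    convex_halfSpace_gt (innerSL ℝ v).isBoundedLinearMap.toIsLinearMap c
  have hqS := convexHull_min (fun x hx => by simpa using (Finset.mem_filter.1 hx).2) hconv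
    (Set.mem_iInter₂.1 hq _ hmem)
  exact hqc.not_gt hqS

/-- If a set `P` of `n` points in `ℝ^d` (`d ≥ 1`) is partitioned into pairwise disjoint
subsets `P_1, …, P_k` each of which is a `1/(d+1)`-net for `P` with respect to closed
halfspaces, then the convex hulls of the parts have a common point; indeed, every point of
Tukey depth at least `n/(d+1)` with respect to `P` lies in every `conv(P_i)`. -/
theorem tverberg_partition_of_nets (d n k : ℕ) (hd : 1 ≤ d)
    (P : Finset (EuclideanSpace ℝ (Fin d))) (hP : P.card = n)
    (Q : Fin k → Finset (EuclideanSpace ℝ (Fin d)))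
    (hsub : ∀ i, Q i ⊆ P)
    (hdisj : ∀ i j, i ≠ j → Disjoint (Q i) (Q j))
    (hcover : (⋃ i, (Q i : Set (EuclideanSpace ℝ (Fin d)))) =
      (P : Set (EuclideanSpace ℝ (Fin d))))
    (hnet : ∀ i, ∀ (v : EuclideanSpace ℝ (Fin d)) (c : ℝ), v ≠ 0 →
      (n : ℝ) / (d + 1) ≤
        (((P : Set (EuclideanSpace ℝ (Fin d))) ∩ {x | ⟪v, x⟫ ≤ c}).ncard : ℝ) →
      ∃ s ∈ Q i, ⟪v, (s : EuclideanSpace ℝ (Fin d))⟫ ≤ c) :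
    (∀ q : EuclideanSpace ℝ (Fin d),
      (∀ (v : EuclideanSpace ℝ (Fin d)) (c : ℝ), v ≠ 0 → ⟪v, q⟫ ≤ c →
        (n : ℝ) / (d + 1) ≤
          (((P : Set (EuclideanSpace ℝ (Fin d))) ∩ {x | ⟪v, x⟫ ≤ c}).ncard : ℝ)) →
      ∀ i, q ∈ convexHull ℝ (Q i : Set (EuclideanSpace ℝ (Fin d)))) ∧
    (⋂ i, convexHull ℝ (Q i : Set (EuclideanSpace ℝ (Fin d)))).Nonempty := by
  have : Nonempty (Fin d) := ⟨⟨0, hd⟩⟩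
  refine (and_iff_left_of_imp fun hdepth => ?_).2 fun q hq i =>
    mem_convexHull_of_forall_halfspace (Q i) q fun v hv => hnet i v _ hv (hq v _ hv le_rfl)
  obtain ⟨q, hq⟩ := exists_centerpoint P
  rw [hP, finrank_euclideanSpace_fin] at hq
  exact ⟨q, Set.mem_iInter.2 (hdepth q fun v c _ => hq v c)⟩
end

section
/- Let P be a set of n = 3k points in the plane ℝ². Then there exists a partition of P into k pairwise disjoint subsets of size 3 whose convex hulls have a common point; that is, there is a point q ∈ ℝ² and a partition of P into k triples T_1, …, T_k with q ∈ conv(T_i) for every i. -/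
/-- If `⟪z, y⟫ < ‖z‖²` then moving from `z` towards `y` decreases the norm. -/
theorem exists_mem_segment_norm_lt {E : Type*} [NormedAddCommGroup E] [InnerProductSpace ℝ E]
    {z y : E} (h : inner ℝ z y < ‖z‖ ^ 2) : ∃ p ∈ segment ℝ z y, ‖p‖ < ‖z‖ := by
  have ha : 0 < ‖z‖ ^ 2 - inner ℝ z y := sub_pos.2 h
  have hb : 0 ≤ ‖y - z‖ ^ 2 := sq_nonneg _
  have hi : inner ℝ z (y - z) = -(‖z‖ ^ 2 - inner ℝ z y) := by
    rw [inner_sub_right, real_inner_self_eq_norm_sq]; ring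
  set a := ‖z‖ ^ 2 - inner ℝ z y
  set b := ‖y - z‖ ^ 2
  have hab : 0 < a + b := by linarith
  have ht : 0 < a / (a + b) := div_pos ha hab
  refine ⟨z + (a / (a + b)) • (y - z), ?_, ?_⟩
  · rw [segment_eq_image']
    exact ⟨a / (a + b), ⟨ht.le, (div_le_one hab).2 (by linarith)⟩, rfl⟩
  · have htb : a / (a + b) * (a + b) = a := div_mul_cancel₀ _ hab.ne'
    set t := a / (a + b)
    have hn : ‖z + t • (y - z)‖ ^ 2 = ‖z‖ ^ 2 - 2 * t * a + t ^ 2 * b := by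
      rw [norm_add_sq_real, inner_smul_right, hi, norm_smul, mul_pow, Real.norm_eq_abs, sq_abs]
      ring
    refine lt_of_pow_lt_pow_left₀ 2 (norm_nonneg _) ?_
    nlinarith [mul_pos ht ha, mul_pos ht ht]

/-- **Colorful Carathéodory theorem**: if `0` is in the convex hull of each of more than
`finrank ℝ E` color classes, then it is in the convex hull of a rainbow choice. -/
theorem exists_zero_mem_convexHull_range {ι κ E : Type*} [Fintype ι] [Finite κ]
    [NormedAddCommGroup E] [InnerProductSpace ℝ E] [FiniteDimensional ℝ E]
    (hcard : Module.finrank ℝ E < Fintype.card ι) (x : ι → κ → E)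
    (hx : ∀ i, (0 : E) ∈ convexHull ℝ (Set.range (x i))) :
    ∃ f : ι → κ, (0 : E) ∈ convexHull ℝ (Set.range fun i => x i (f i)) := by
  classical
  have hι : Nonempty ι := Fintype.card_pos_iff.1 (by omega)
  have hκ : Nonempty κ :=
    Set.range_nonempty_iff_nonempty.1 ((convexHull_nonempty_iff (𝕜 := ℝ)).1 ⟨0, hx hι.some⟩)
  let K : (ι → κ) → Set E := fun f => convexHull ℝ (Set.range fun i => x i (f i))
  obtain ⟨f, hf⟩ := Finite.exists_min fun f => Metric.infDist (0 : E) (K f)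
  refine ⟨f, ?_⟩
  have hcomp : IsCompact (K f) := (Set.finite_range _).isCompact_convexHull ℝ
  have hne : (K f).Nonempty := convexHull_nonempty_iff.2 (Set.range_nonempty _)
  obtain ⟨z, hzK, hz⟩ := hcomp.exists_infDist_eq_dist hne 0
  rw [dist_zero_left] at hz
  have hmin : ∀ g, ∀ p ∈ K g, ‖z‖ ≤ ‖p‖ := fun g p hp => by
    rw [← hz, ← dist_zero_left p]
    exact (hf g).trans (Metric.infDist_le_dist_of_mem hp)
  by_contra h0
  have hz0 : z ≠ 0 := fun h => h0 (h ▸ hzK)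
  have hzpos : 0 < ‖z‖ ^ 2 := by positivity
  have hge : ∀ g, z ∈ K g → ∀ y ∈ K g, ‖z‖ ^ 2 ≤ inner ℝ z y := fun g hzg y hy => by
    by_contra! h
    obtain ⟨p, hp, hlt⟩ := exists_mem_segment_norm_lt h
    exact absurd (hmin g p ((convex_convexHull ℝ _).segment_subset hzg hy hp)) hlt.not_ge
  obtain ⟨α, _, y, w, hyr, hyi, hw, hw1, hwz⟩ := eq_pos_convex_span_of_mem_convexHull hzK
  have hyK : ∀ a, y a ∈ K f := fun a => subset_convexHull ℝ _ (hyr ⟨a, rfl⟩)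
  have hyz : ∀ a, inner ℝ z (y a) = ‖z‖ ^ 2 := by
    have hsum : ∑ a, w a * (inner ℝ z (y a) - ‖z‖ ^ 2) = 0 := by
      simp only [mul_sub, Finset.sum_sub_distrib, ← Finset.sum_mul, hw1, ← inner_smul_right,
        ← inner_sum, hwz, real_inner_self_eq_norm_sq]
      ring
    intro a
    have := (Finset.sum_eq_zero_iff_of_nonneg fun a _ =>
      mul_nonneg (hw a).le (sub_nonneg.2 (hge f hzK _ (hyK a)))).1 hsum a (Finset.mem_univ a)
    exact sub_eq_zero.1 ((mul_eq_zero.1 this).resolve_left (hw a).ne')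
  have hli : LinearIndependent ℝ y := by
    rw [linearIndependent_iff']
    intro s c hc
    refine affineIndependent_iff.1 hyi s c ?_ hc
    have : inner ℝ z (∑ i ∈ s, c i • y i) = 0 := by rw [hc, inner_zero_right]
    simp only [inner_sum, inner_smul_right, hyz, ← Finset.sum_mul] at this
    exact (mul_eq_zero.1 this).resolve_right hzpos.ne'
  choose g hg using fun a => hyr ⟨a, rfl⟩
  obtain ⟨i₀, hi₀⟩ : ∃ i₀, ∀ a, g a ≠ i₀ := by
    by_contra! h
    have := Fintype.card_le_of_surjective g h
    have := hli.fintype_card_le_finrank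
    omega
  obtain ⟨c, hc⟩ : ∃ c, inner ℝ z (x i₀ c) ≤ 0 := by
    by_contra! h
    have hsub : convexHull ℝ (Set.range (x i₀)) ⊆ {p | 0 < inner ℝ z p} :=
      convexHull_min (by rintro _ ⟨c, rfl⟩; exact h c)
        (convex_halfSpace_gt (innerₛₗ ℝ z).isLinear 0)
    simpa using hsub (hx i₀)
  have hcK : x i₀ c ∈ K (Function.update f i₀ c) :=
    subset_convexHull ℝ _ ⟨i₀, by simp⟩
  have hzK' : z ∈ K (Function.update f i₀ c) := by
    rw [← hwz]
    refine (convex_convexHull ℝ _).sum_mem (fun a _ => (hw a).le) hw1 fun a _ =>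
      subset_convexHull ℝ _ ⟨g a, ?_⟩
    rw [← hg a]
    simp [Function.update_of_ne (hi₀ a)]
  linarith [hge _ hzK' _ hcK]

/-- Tverberg's theorem in the plane, for a family of more than `3 * m` points and `m + 1` parts. -/
theorem exists_coloring_mem_convexHull {ι : Type*} [Fintype ι] {m : ℕ}
    (hcard : 3 * m < Fintype.card ι) (v : ι → EuclideanSpace ℝ (Fin 2)) :
    ∃ (q : EuclideanSpace ℝ (Fin 2)) (f : ι → Fin (m + 1)),
      ∀ j, q ∈ convexHull ℝ (v '' {i | f i = j}) := by
  classical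
  let V : ι → Fin 3 → ℝ := fun i => ![v i 0, v i 1, 1]
  let W : Fin (m + 1) → Fin m → ℝ :=
    fun j a => (if j = a.succ then 1 else 0) - (if j = 0 then 1 else 0)
  let x : ι → Fin (m + 1) → EuclideanSpace ℝ (Fin m × Fin 3) :=
    fun i j => WithLp.toLp 2 fun p => V i p.2 * W j p.1
  have hx : ∀ i, (0 : EuclideanSpace ℝ (Fin m × Fin 3)) ∈ convexHull ℝ (Set.range (x i)) := by
    intro i
    have hsum : ∑ j : Fin (m + 1), ((m + 1 : ℝ)⁻¹) • x i j = 0 := by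
      ext p
      simp [x, W, ← Finset.mul_sum]
    rw [← hsum]
    refine (convex_convexHull ℝ _).sum_mem (fun _ _ => by positivity) ?_ fun j _ =>
      subset_convexHull ℝ _ ⟨j, rfl⟩
    simp
    field_simp
  obtain ⟨f, hf⟩ := exists_zero_mem_convexHull_range (by simpa [mul_comm] using hcard) x hx
  rw [convexHull_range_eq_exists_affineCombination] at hf
  obtain ⟨s, w, hw0, hw1, hw⟩ := hf
  rw [Finset.affineCombination_eq_linear_combination _ _ _ hw1] at hw
  let S : Fin (m + 1) → Fin 3 → ℝ := fun j c => ∑ i ∈ s with f i = j, w i * V i c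
  have hS : ∀ j c, S j c = S 0 c := by
    intro j c
    refine Fin.cases rfl (fun a => ?_) j
    have h := congrArg (fun p : EuclideanSpace ℝ (Fin m × Fin 3) => p (a, c)) hw
    simp only [x, W, WithLp.ofLp_sum, Finset.sum_apply, PiLp.smul_apply, smul_eq_mul,
      PiLp.zero_apply, mul_sub, mul_ite, mul_one, mul_zero, Finset.sum_sub_distrib] at h
    simp only [S, Finset.sum_filter]
    linarith
  have hS2 : ∀ j, S j 2 = ∑ i ∈ s with f i = j, w i := by simp [S, V]
  have htot : ∑ j, S j 2 = 1 := by
    simp only [hS2, Finset.sum_fiberwise, hw1]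
  have hpos : 0 < S 0 2 := by
    simp only [hS _ 2, Finset.sum_const, nsmul_eq_mul] at htot
    refine pos_of_mul_pos_right (htot ▸ one_pos) (by positivity)
  refine ⟨!₂[S 0 0 / S 0 2, S 0 1 / S 0 2], f, fun j => ?_⟩
  have hq : !₂[S 0 0 / S 0 2, S 0 1 / S 0 2] = (s.filter (f · = j)).centerMass w v := by
    rw [← hS j 0, ← hS j 1, ← hS j 2, Finset.centerMass, ← hS2]
    ext c
    fin_cases c
    · simp [S, V, div_eq_inv_mul]
    · simp [S, V, div_eq_inv_mul]
  rw [hq]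
  refine Finset.centerMass_mem_convexHull _ (fun i hi => hw0 i (Finset.mem_filter.1 hi).1) ?_
    fun i hi => ⟨i, (Finset.mem_filter.1 hi).2, rfl⟩
  rw [← hS2, hS]
  exact hpos

/-- Disjoint sets of size at most `n` inside a set of size `n * #s` extend to a partition of it
into sets of size `n`. -/
theorem exists_partition_superset {ι α : Type*} [DecidableEq ι] [DecidableEq α] {n : ℕ}
    (s : Finset ι) (t : ι → Finset α) :
    ∀ P : Finset α, P.card = n * s.card → (∀ i ∈ s, t i ⊆ P) → (∀ i ∈ s, (t i).card ≤ n) →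
      (s : Set ι).PairwiseDisjoint t →
      ∃ T : ι → Finset α, (∀ i ∈ s, t i ⊆ T i) ∧ (∀ i ∈ s, (T i).card = n) ∧
        (s : Set ι).PairwiseDisjoint T ∧ s.biUnion T = P := by
  induction s using Finset.induction_on with
  | empty =>
    intro P hP _ _ _
    exact ⟨t, by simp, by simp, by simp, by simpa using (by simpa using hP : P = ∅).symm⟩
  | insert a s ha ih =>
    intro P hP htP htn htd
    rw [Finset.card_insert_of_notMem ha] at hP
    have hdisj : ∀ i ∈ s, Disjoint (t a) (t i) := fun i hi =>
      htd (by simp) (by simp [hi]) (fun h => ha (h ▸ hi))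
    have hU : (s.biUnion t).card ≤ n * s.card := by
      rw [mul_comm]
      exact Finset.card_biUnion_le_card_mul _ _ _ fun i hi => htn i (Finset.mem_insert_of_mem hi)
    obtain ⟨u, htu, hu, hun⟩ := Finset.exists_subsuperset_card_eq (n := n)
      (show t a ⊆ P \ s.biUnion t from Finset.subset_sdiff.2
        ⟨htP a (Finset.mem_insert_self _ _), (Finset.disjoint_biUnion_right _ _ _).2 hdisj⟩)
      (htn a (Finset.mem_insert_self _ _))
      (by have := Finset.le_card_sdiff (s.biUnion t) P; rw [mul_add] at hP; omega)
    obtain ⟨huP, hud⟩ := Finset.subset_sdiff.1 hu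
    obtain ⟨T, hT, hTn, hTd, hTP⟩ := ih (P \ u)
      (by rw [Finset.card_sdiff_of_subset huP, hP, hun, mul_add, mul_one, Nat.add_sub_cancel])
      (fun i hi => Finset.subset_sdiff.2 ⟨htP i (Finset.mem_insert_of_mem hi),
        ((Finset.disjoint_biUnion_right _ _ _).1 hud i hi).symm⟩)
      (fun i hi => htn i (Finset.mem_insert_of_mem hi))
      (htd.subset (by simp))
    have hTu : ∀ i ∈ s, Disjoint u (T i) := fun i hi =>
      Finset.disjoint_of_subset_right (hTP ▸ Finset.subset_biUnion_of_mem T hi)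
        Finset.disjoint_sdiff
    have hne : ∀ i ∈ s, i ≠ a := fun i hi h => ha (h ▸ hi)
    have hTi : ∀ i ∈ s, Function.update T a u i = T i := fun i hi =>
      Function.update_of_ne (hne i hi) _ _
    refine ⟨Function.update T a u, ?_, ?_, ?_, ?_⟩
    · rw [Finset.forall_mem_insert]
      exact ⟨by simpa using htu, fun i hi => by rw [hTi i hi]; exact hT i hi⟩
    · rw [Finset.forall_mem_insert]
      exact ⟨by simpa using hun, fun i hi => by rw [hTi i hi]; exact hTn i hi⟩
    · rw [Finset.coe_insert, Set.pairwiseDisjoint_insert_of_notMem (by simpa using ha)]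
      refine ⟨fun i hi j hj hij => ?_, fun i hi => ?_⟩
      · simp only [Function.onFun, hTi i hi, hTi j hj]
        exact hTd hi hj hij
      · rw [Function.update_self, hTi i hi]
        exact hTu i hi
    · rw [Finset.biUnion_insert, Function.update_self, Finset.biUnion_congr rfl hTi, hTP,
        Finset.union_sdiff_of_subset huP]


/-- **Birch's theorem.** Any set of `n = 3k` points in the plane can be partitioned into
`k` pairwise disjoint triples whose convex hulls (triangles) have a common point. -/
theorem birch (k : ℕ) (P : Finset (EuclideanSpace ℝ (Fin 2))) (hP : P.card = 3 * k) :
    ∃ (q : EuclideanSpace ℝ (Fin 2)) (T : Fin k → Finset (EuclideanSpace ℝ (Fin 2))),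
      (∀ i, T i ⊆ P) ∧
      (∀ i, (T i).card = 3) ∧
      (∀ i j, i ≠ j → Disjoint (T i) (T j)) ∧
      (⋃ i, (T i : Set (EuclideanSpace ℝ (Fin 2)))) = (P : Set (EuclideanSpace ℝ (Fin 2))) ∧
      ∀ i, q ∈ convexHull ℝ (T i : Set (EuclideanSpace ℝ (Fin 2))) := by
  classical
  obtain _ | m := k
  · have : P = ∅ := by simpa using hP
    exact ⟨0, Fin.elim0, by simp, by simp, by simp, by simp [this], by simp⟩
  obtain ⟨q, f, hq⟩ := exists_coloring_mem_convexHull (m := m)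
    (by rw [Fintype.card_coe]; omega) (fun i : P => (i : EuclideanSpace ℝ (Fin 2)))
  choose t ht hti hqt using fun j => by
    simpa only [Set.mem_iUnion, exists_prop] using convexHull_eq_union.subset (hq j)
  have htP : ∀ j, t j ⊆ P := fun j y hy => by
    obtain ⟨i, _, rfl⟩ := ht j hy
    exact i.2
  have htn : ∀ j, (t j).card ≤ 3 := fun j => by
    simpa using (hti j).card_le_finrank_succ.trans
      (Nat.succ_le_succ (Submodule.finrank_le _))
  have htd : ((Finset.univ : Finset (Fin (m + 1))) : Set (Fin (m + 1))).PairwiseDisjoint t := by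
    intro i _ j _ hij
    refine Finset.disjoint_left.2 fun y hyi hyj => hij ?_
    obtain ⟨a, rfl, rfl⟩ := ht i hyi
    obtain ⟨b, rfl, hab⟩ := ht j hyj
    rw [Subtype.ext hab]
  obtain ⟨T, hT, hTn, hTd, hTP⟩ := exists_partition_superset Finset.univ t P (by simpa using hP)
    (fun j _ => htP j) (fun j _ => htn j) htd
  refine ⟨q, T, fun j => hTP ▸ Finset.subset_biUnion_of_mem T (Finset.mem_univ j),
    fun j => hTn j (Finset.mem_univ j), fun i j hij => hTd (by simp) (by simp) hij, ?_,
    fun j => convexHull_mono (Finset.coe_subset.2 (hT j (Finset.mem_univ j))) (hqt j)⟩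
  simp [← hTP]
end

section
/- Let P be a set of n points in the plane ℝ² and let q ∈ ℝ² be a point with q ∉ P such that P ∪ {q} is in general position (no three of its points are collinear). Suppose the Tukey depth k of q with respect to P satisfies k ≤ n/3. Then there exist k pairwise disjoint subsets of P, each of size 3, such that the convex hull of each subset contains q. -/
open scoped RealInnerProductSpace

open Filter Topology

/-- The points of a finite set can be enumerated so that a real-valued key is monotone. -/
lemma Finset.exists_monotone_equiv {α : Type*} (s : Finset α) (f : α → ℝ) :
    ∃ e : Fin s.card ≃ s, Monotone fun i => f (e i) :=
  ⟨(Tuple.sort fun i => f (s.equivFin.symm i)).trans s.equivFin.symm,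
    Tuple.monotone_sort fun i => f (s.equivFin.symm i)⟩

lemma card_filter_ge_le_of_monotone {α : Type*} {s : Finset α} {f : α → ℝ}
    {e : Fin s.card ≃ s} (he : Monotone fun i => f (e i)) {i : Fin s.card} {μ : ℝ}
    (h : f (e i) < μ) : (s.filter fun x => μ ≤ f x).card ≤ s.card - 1 - i := by
  classical
  rw [← Fin.card_Ioi]
  refine (Finset.card_le_card ?_).trans
    (Finset.card_image_le (s := Finset.Ioi i) (f := fun j => (e j : α)))
  intro x hx
  rw [Finset.mem_filter] at hx
  refine Finset.mem_image.2 ⟨e.symm ⟨x, hx.1⟩, Finset.mem_Ioi.2 (lt_of_not_ge fun hle => ?_), ?_⟩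
  · have := he hle
    simp only [Equiv.apply_symm_apply] at this
    linarith [hx.2]
  · simp

lemma card_filter_le_le_of_monotone {α : Type*} {s : Finset α} {f : α → ℝ}
    {e : Fin s.card ≃ s} (he : Monotone fun i => f (e i)) {i : Fin s.card} {μ : ℝ}
    (h : μ < f (e i)) : (s.filter fun x => f x ≤ μ).card ≤ i := by
  classical
  rw [← Fin.card_Iio]
  refine (Finset.card_le_card ?_).trans
    (Finset.card_image_le (s := Finset.Iio i) (f := fun j => (e j : α)))
  intro x hx
  rw [Finset.mem_filter] at hx
  refine Finset.mem_image.2 ⟨e.symm ⟨x, hx.1⟩, Finset.mem_Iio.2 (lt_of_not_ge fun hle => ?_), ?_⟩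
  · have := he hle
    simp only [Equiv.apply_symm_apply] at this
    linarith [hx.2]
  · simp

/-- If every threshold `μ` has at least `#A` points among those of `A` on one side and those of `B`
on the other side, for both choices of sides, then every point of `A` can be matched with
two points of `B` whose keys enclose its own, all these points of `B` being distinct. -/
lemma exists_enclosing_matching {α : Type*} {A B : Finset α} {f : α → ℝ}
    (hAB : 2 * A.card ≤ B.card)
    (hge : ∀ μ, A.card ≤ (A.filter fun x => μ ≤ f x).card + (B.filter fun x => f x ≤ μ).card)
    (hle : ∀ μ, A.card ≤ (A.filter fun x => f x ≤ μ).card + (B.filter fun x => μ ≤ f x).card) :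
    ∃ a b c : Fin A.card → α, (∀ i, a i ∈ A) ∧ (∀ i, b i ∈ B) ∧ (∀ i, c i ∈ B) ∧
      a.Injective ∧ b.Injective ∧ c.Injective ∧ (∀ i j, b i ≠ c j) ∧
      ∀ i, f (b i) ≤ f (a i) ∧ f (a i) ≤ f (c i) := by
  obtain ⟨e, he⟩ := A.exists_monotone_equiv f
  obtain ⟨g, hg⟩ := B.exists_monotone_equiv f
  let lo : Fin A.card → Fin B.card := fun i => ⟨i, by omega⟩
  let hi : Fin A.card → Fin B.card := fun i => ⟨B.card - A.card + i, by omega⟩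
  refine ⟨fun i => e i, fun i => g (lo i), fun i => g (hi i), fun i => (e i).2,
    fun i => (g _).2, fun i => (g _).2, Subtype.val_injective.comp e.injective, ?_, ?_, ?_, ?_⟩
  · refine Subtype.val_injective.comp (g.injective.comp fun i j h => ?_)
    simp only [lo, Fin.mk.injEq] at h
    exact Fin.ext h
  · refine Subtype.val_injective.comp (g.injective.comp fun i j h => ?_)
    simp only [hi, Fin.mk.injEq] at h
    exact Fin.ext (by omega)
  · intro i j h
    have := g.injective (Subtype.val_injective h)
    simp only [lo, hi, Fin.mk.injEq] at this
    omega
  · intro i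
    constructor
    · by_contra! h
      obtain ⟨μ, h₁, h₂⟩ := exists_between h
      have := card_filter_ge_le_of_monotone he h₁
      have := card_filter_le_le_of_monotone hg h₂
      have := hge μ
      simp only [lo] at *
      omega
    · by_contra! h
      obtain ⟨μ, h₁, h₂⟩ := exists_between h
      have := card_filter_ge_le_of_monotone hg h₁
      have := card_filter_le_le_of_monotone he h₂
      have := hle μ
      simp only [hi] at *
      omega

lemma tukeyDepth_le_card_filter {d : ℕ} (P : Finset (EuclideanSpace ℝ (Fin d)))
    (q : EuclideanSpace ℝ (Fin d)) {v : EuclideanSpace ℝ (Fin d)} (hv : v ≠ 0) :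
    tukeyDepth (P : Set (EuclideanSpace ℝ (Fin d))) q
      ≤ (P.filter fun x => ⟪v, x - q⟫ ≤ 0).card := by
  refine Nat.sInf_le ⟨v, ⟪v, q⟫, hv, le_rfl, ?_⟩
  rw [← Set.ncard_coe_finset]
  congr 1
  ext x
  simp [inner_sub_right]

lemma exists_card_filter_eq_tukeyDepth {d : ℕ} [NeZero d]
    (P : Finset (EuclideanSpace ℝ (Fin d))) (q : EuclideanSpace ℝ (Fin d)) :
    ∃ v : EuclideanSpace ℝ (Fin d), v ≠ 0 ∧ (P.filter fun x => ⟪v, x - q⟫ ≤ 0).card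
      = tukeyDepth (P : Set (EuclideanSpace ℝ (Fin d))) q := by
  obtain ⟨w, hw⟩ := exists_ne (0 : EuclideanSpace ℝ (Fin d))
  obtain ⟨v, c, hv, hc, hcard⟩ := Nat.sInf_mem (s := { m : ℕ | ∃ (v : EuclideanSpace ℝ (Fin d))
    (c : ℝ), v ≠ 0 ∧ ⟪v, q⟫ ≤ c ∧
      ((P : Set (EuclideanSpace ℝ (Fin d))) ∩ {x | ⟪v, x⟫ ≤ c}).ncard = m })
    ⟨_, w, ⟪w, q⟫, hw, le_rfl, rfl⟩
  refine ⟨v, hv, le_antisymm ?_ (tukeyDepth_le_card_filter P q hv)⟩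
  rw [tukeyDepth, ← hcard, ← Set.ncard_coe_finset]
  refine Set.ncard_le_ncard (fun x hx => ?_) (P.finite_toSet.inter_of_left _)
  simp only [Finset.coe_filter, Set.mem_ofPred_eq, inner_sub_right] at hx
  exact ⟨hx.1, by simpa using (show ⟪v, x⟫ ≤ c by linarith [hx.2])⟩

/-- Rotation of the plane by a right angle. -/
def quarterTurn (v : EuclideanSpace ℝ (Fin 2)) : EuclideanSpace ℝ (Fin 2) := !₂[-v 1, v 0]

lemma inner_quarterTurn_self (v : EuclideanSpace ℝ (Fin 2)) : ⟪quarterTurn v, v⟫ = 0 := by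
  simp [quarterTurn, PiLp.inner_apply]
  ring

lemma eq_zero_of_inner_eq_zero {v y : EuclideanSpace ℝ (Fin 2)} (hv : v ≠ 0)
    (h₁ : ⟪v, y⟫ = 0) (h₂ : ⟪quarterTurn v, y⟫ = 0) : y = 0 := by
  simp [quarterTurn, PiLp.inner_apply] at h₁ h₂
  have hpos : v 0 ^ 2 + v 1 ^ 2 ≠ 0 := fun h => hv <| by
    ext i
    fin_cases i
    · simpa using show v 0 = 0 by nlinarith [sq_nonneg (v 0), sq_nonneg (v 1)]
    · simpa using show v 1 = 0 by nlinarith [sq_nonneg (v 0), sq_nonneg (v 1)]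
  have h0 : (v 0 ^ 2 + v 1 ^ 2) * y 0 = 0 := by linear_combination v 0 * h₁ - v 1 * h₂
  have h1 : (v 0 ^ 2 + v 1 ^ 2) * y 1 = 0 := by linear_combination v 1 * h₁ + v 0 * h₂
  ext i
  fin_cases i
  · simpa [hpos] using h0
  · simpa [hpos] using h1

lemma add_smul_quarterTurn_ne_zero {v : EuclideanSpace ℝ (Fin 2)} (hv : v ≠ 0) (ε : ℝ) :
    v + ε • quarterTurn v ≠ 0 := by
  intro h
  have := congrArg (fun y => ⟪y, v⟫) h
  simp [inner_add_left, inner_smul_left, inner_quarterTurn_self, hv] at this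

lemma quarterTurn_sub_smul_ne_zero {v : EuclideanSpace ℝ (Fin 2)} (hv : v ≠ 0) (μ : ℝ) :
    quarterTurn v - μ • v ≠ 0 := by
  intro h
  have h₁ : ⟪v, quarterTurn v⟫ = 0 := by rw [real_inner_comm, inner_quarterTurn_self]
  have h₂ : quarterTurn v = μ • v := sub_eq_zero.1 h
  have hμ : μ = 0 := by simpa [h₂, inner_smul_right, hv] using h₁
  rw [hμ, zero_smul] at h₂
  have h0 := congrArg (fun y => y 0) h₂
  have h1 := congrArg (fun y => y 1) h₂
  simp [quarterTurn] at h0 h1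
  refine hv ?_
  ext i
  fin_cases i
  · simpa using h1
  · simpa using h0

/-- The Tukey depth is attained by a halfplane with no point of `P` on its boundary line, which
passes through `q`. -/
lemma exists_card_filter_eq_tukeyDepth_of_notMem {P : Finset (EuclideanSpace ℝ (Fin 2))}
    {q : EuclideanSpace ℝ (Fin 2)} (hq : q ∉ P) :
    ∃ v : EuclideanSpace ℝ (Fin 2), v ≠ 0 ∧ (P.filter fun x => ⟪v, x - q⟫ ≤ 0).card
      = tukeyDepth (P : Set (EuclideanSpace ℝ (Fin 2))) q ∧ ∀ x ∈ P, ⟪v, x - q⟫ ≠ 0 := by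
  obtain ⟨v, hv, hcard⟩ := exists_card_filter_eq_tukeyDepth P q
  have hev : ∀ᶠ ε : ℝ in 𝓝[>] 0, ∀ x ∈ P,
      (0 < ⟪v, x - q⟫ → 0 < ⟪v + ε • quarterTurn v, x - q⟫) ∧
      (⟪v, x - q⟫ < 0 → ⟪v + ε • quarterTurn v, x - q⟫ < 0) := by
    rw [Filter.eventually_all_finset]
    intro x _
    have hlim : Tendsto (fun ε : ℝ => ⟪v + ε • quarterTurn v, x - q⟫) (𝓝[>] 0)
        (𝓝 ⟪v, x - q⟫) := by
      have : Continuous fun ε : ℝ => ⟪v + ε • quarterTurn v, x - q⟫ := by fun_prop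
      simpa using (this.tendsto 0).mono_left nhdsWithin_le_nhds
    exact (eventually_imp_distrib_left.2 fun h => hlim.eventually_const_lt h).and
      (eventually_imp_distrib_left.2 fun h => hlim.eventually_lt_const h)
  obtain ⟨ε, hε, hε0⟩ := (hev.and self_mem_nhdsWithin).exists
  have hε0 : 0 < ε := hε0
  have hw := add_smul_quarterTurn_ne_zero hv ε
  refine ⟨_, hw, le_antisymm ?_ (tukeyDepth_le_card_filter P q hw), fun x hx h0 => ?_⟩
  · rw [← hcard]
    refine Finset.card_le_card fun x hx => ?_
    rw [Finset.mem_filter] at hx ⊢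
    exact ⟨hx.1, not_lt.1 fun h => (hε x hx.1).1 h |>.not_ge hx.2⟩
  · have h₁ : ⟪v, x - q⟫ = 0 := by
      rcases lt_trichotomy ⟪v, x - q⟫ 0 with h | h | h
      · exact absurd h0 ((hε x hx).2 h).ne
      · exact h
      · exact absurd h0 ((hε x hx).1 h).ne'
    have h₂ : ⟪quarterTurn v, x - q⟫ = 0 := by
      rw [inner_add_left, inner_smul_left, h₁] at h0
      simpa [hε0.ne'] using h0
    exact hq (sub_eq_zero.1 (eq_zero_of_inner_eq_zero hv h₁ h₂) ▸ hx)

lemma mem_convexHull_triple_of_smul_eq_zero {E : Type*} [AddCommGroup E] [Module ℝ E]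
    {a b c q : E} {α β γ : ℝ} (hα : 0 < α) (hβ : 0 ≤ β) (hγ : 0 ≤ γ)
    (h : α • (a - q) + β • (b - q) + γ • (c - q) = 0) :
    q ∈ convexHull ℝ ({a, b, c} : Set E) := by
  have hs : 0 < α + β + γ := by positivity
  have key : q = (α + β + γ)⁻¹ • (α • a + β • b + γ • c) := by
    rw [eq_inv_smul_iff₀ hs.ne', ← sub_eq_zero, ← neg_eq_zero, ← h]
    module
  have := (convex_convexHull ℝ ({a, b, c} : Set E)).sum_mem (t := Finset.univ)
    (w := ![α / (α + β + γ), β / (α + β + γ), γ / (α + β + γ)]) (z := ![a, b, c])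
    (by intro i _; fin_cases i <;> simp <;> positivity)
    (by simp [Fin.sum_univ_three]; field_simp)
    (by intro i _; fin_cases i <;> exact subset_convexHull ℝ _ (by simp))
  rw [key]
  convert this using 1
  simp [Fin.sum_univ_three, smul_smul, div_eq_inv_mul]

/-- The slope of `y` in the coordinate system spanned by `v` and its quarter turn. -/
noncomputable def slopeAlong (v y : EuclideanSpace ℝ (Fin 2)) : ℝ := ⟪quarterTurn v, y⟫ / ⟪v, y⟫

lemma inner_quarterTurn_sub_smul {v y : EuclideanSpace ℝ (Fin 2)} (hy : ⟪v, y⟫ ≠ 0) (μ : ℝ) :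
    ⟪quarterTurn v - μ • v, y⟫ = (slopeAlong v y - μ) * ⟪v, y⟫ := by
  rw [inner_sub_left, inner_smul_left, slopeAlong, sub_mul, div_mul_cancel₀ _ hy]
  simp

lemma mem_convexHull_of_slopeAlong {v q a b c : EuclideanSpace ℝ (Fin 2)} (hv : v ≠ 0)
    (ha : ⟪v, a - q⟫ < 0) (hb : 0 < ⟪v, b - q⟫) (hc : 0 < ⟪v, c - q⟫)
    (hba : slopeAlong v (b - q) ≤ slopeAlong v (a - q))
    (hac : slopeAlong v (a - q) ≤ slopeAlong v (c - q)) :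
    q ∈ convexHull ℝ ({a, b, c} : Set (EuclideanSpace ℝ (Fin 2))) := by
  have hmem : slopeAlong v (a - q) ∈ segment ℝ (slopeAlong v (b - q)) (slopeAlong v (c - q)) := by
    rw [segment_eq_Icc (hba.trans hac)]
    exact ⟨hba, hac⟩
  obtain ⟨s, t, hs, ht, hst, hcomb⟩ := hmem
  simp only [slopeAlong, smul_eq_mul] at hcomb
  refine mem_convexHull_triple_of_smul_eq_zero (α := (-⟪v, a - q⟫)⁻¹) (β := s / ⟪v, b - q⟫)
    (γ := t / ⟪v, c - q⟫) (inv_pos.2 (neg_pos.2 ha)) (by positivity) (by positivity)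
    (eq_zero_of_inner_eq_zero hv ?_ ?_)
  · simp only [inner_add_right, inner_smul_right, div_mul_cancel₀ _ hb.ne',
      div_mul_cancel₀ _ hc.ne', inv_neg, neg_mul, inv_mul_cancel₀ ha.ne]
    linarith
  · simp only [inner_add_right, inner_smul_right]
    rw [inv_neg]
    linear_combination hcomb

/-- The depth bound for the two halfplanes bounded by the line through `q` of slope `μ` relative
to `v`, in terms of the slopes of the points on either side of the normal halfplane of `v`. -/
lemma tukeyDepth_le_card_slopeAlong {P : Finset (EuclideanSpace ℝ (Fin 2))}
    {q v : EuclideanSpace ℝ (Fin 2)} (hv : v ≠ 0) (hne : ∀ x ∈ P, ⟪v, x - q⟫ ≠ 0) (μ : ℝ) :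
    tukeyDepth (P : Set (EuclideanSpace ℝ (Fin 2))) q ≤
      ((P.filter fun x => ⟪v, x - q⟫ ≤ 0).filter fun x => μ ≤ slopeAlong v (x - q)).card +
      ((P.filter fun x => ¬ ⟪v, x - q⟫ ≤ 0).filter fun x => slopeAlong v (x - q) ≤ μ).card ∧
    tukeyDepth (P : Set (EuclideanSpace ℝ (Fin 2))) q ≤
      ((P.filter fun x => ⟪v, x - q⟫ ≤ 0).filter fun x => slopeAlong v (x - q) ≤ μ).card +
      ((P.filter fun x => ¬ ⟪v, x - q⟫ ≤ 0).filter fun x => μ ≤ slopeAlong v (x - q)).card := by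
  classical
  have hw := quarterTurn_sub_smul_ne_zero hv μ
  constructor
  · refine (tukeyDepth_le_card_filter P q hw).trans
      ((Finset.card_le_card fun x hx => ?_).trans (Finset.card_union_le _ _))
    simp only [Finset.mem_filter, Finset.mem_union] at hx ⊢
    obtain ⟨hxP, hx⟩ := hx
    rw [inner_quarterTurn_sub_smul (hne x hxP)] at hx
    rcases (hne x hxP).lt_or_gt with h | h
    · exact .inl ⟨⟨hxP, h.le⟩, by nlinarith⟩
    · exact .inr ⟨⟨hxP, h.not_ge⟩, by nlinarith⟩
  · refine (tukeyDepth_le_card_filter P q (neg_ne_zero.2 hw)).trans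
      ((Finset.card_le_card fun x hx => ?_).trans (Finset.card_union_le _ _))
    simp only [Finset.mem_filter, Finset.mem_union] at hx ⊢
    obtain ⟨hxP, hx⟩ := hx
    rw [inner_neg_left, inner_quarterTurn_sub_smul (hne x hxP)] at hx
    rcases (hne x hxP).lt_or_gt with h | h
    · exact .inl ⟨⟨hxP, h.le⟩, by nlinarith⟩
    · exact .inr ⟨⟨hxP, h.not_ge⟩, by nlinarith⟩

/-- **Shallow points in the plane.** Let `P` be a set of `n` points in the plane and
`q ∉ P` a point such that `P ∪ {q}` is in general position (no three points collinear).
If the Tukey depth `k` of `q` with respect to `P` satisfies `k ≤ n/3`, then there are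
`k` pairwise disjoint triples of points of `P` whose convex hulls all contain `q`. -/
theorem shallow_tverberg_eq_tukey (n k : ℕ)
    (P : Finset (EuclideanSpace ℝ (Fin 2))) (hP : P.card = n)
    (q : EuclideanSpace ℝ (Fin 2)) (hq : q ∉ P)
    (hgp : ∀ x ∈ insert q (P : Set (EuclideanSpace ℝ (Fin 2))),
      ∀ y ∈ insert q (P : Set (EuclideanSpace ℝ (Fin 2))),
      ∀ z ∈ insert q (P : Set (EuclideanSpace ℝ (Fin 2))),
      x ≠ y → x ≠ z → y ≠ z →
        ¬ Collinear ℝ ({x, y, z} : Set (EuclideanSpace ℝ (Fin 2))))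
    (hdepth : tukeyDepth (P : Set (EuclideanSpace ℝ (Fin 2))) q = k)
    (hk : 3 * k ≤ n) :
    ∃ T : Fin k → Finset (EuclideanSpace ℝ (Fin 2)),
      (∀ i, T i ⊆ P) ∧
      (∀ i, (T i).card = 3) ∧
      (∀ i j, i ≠ j → Disjoint (T i) (T j)) ∧
      ∀ i, q ∈ convexHull ℝ (T i : Set (EuclideanSpace ℝ (Fin 2))) := by
  classical
  obtain ⟨v, hv, hcard, hne⟩ := exists_card_filter_eq_tukeyDepth_of_notMem hq
  have hslope := tukeyDepth_le_card_slopeAlong hv hne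
  have hsum := P.card_filter_add_card_filter_not fun x => ⟪v, x - q⟫ ≤ 0
  rw [← hcard] at hslope
  rw [hdepth] at hcard
  subst hcard
  obtain ⟨a, b, c, ha, hb, hc, hai, hbi, hci, hbc, hsl⟩ :=
    exists_enclosing_matching (f := fun x => slopeAlong v (x - q)) (by omega)
      (fun μ => (hslope μ).1) fun μ => (hslope μ).2
  simp only [Finset.mem_filter] at ha hb hc
  have hab : ∀ i j, a i ≠ b j := fun i j h => (hb j).2 (h ▸ (ha i).2)
  have hac : ∀ i j, a i ≠ c j := fun i j h => (hc j).2 (h ▸ (ha i).2)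
  refine ⟨fun i => {a i, b i, c i}, fun i => ?_, fun i => ?_, fun i j hij => ?_, fun i => ?_⟩
  · simp [Finset.insert_subset_iff, (ha i).1, (hb i).1, (hc i).1]
  · exact Finset.card_eq_three.2 ⟨_, _, _, hab i i, hac i i, hbc i i, rfl⟩
  · simp [hai.ne hij.symm, hbi.ne hij.symm, hci.ne hij.symm, hab, hac, hbc, (hab _ _).symm,
      (hac _ _).symm, (hbc _ _).symm]
  · simpa using mem_convexHull_of_slopeAlong hv (lt_of_le_of_ne (ha i).2 (hne _ (ha i).1))
      (not_le.1 (hb i).2) (not_le.1 (hc i).2) (hsl i).1 (hsl i).2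
end

section
/- Let P be a set of n points in the plane ℝ² and let q ∈ ℝ² be a point with q ∉ P such that P ∪ {q} is in general position (no three of its points are collinear). Suppose the Tukey depth of q with respect to P is strictly greater than n/3. Then there exist s = ⌊n/3⌋ pairwise disjoint subsets of P, each of size 3, such that the convex hull of each subset contains q. -/
open scoped RealInnerProductSpace

/-- The polar angle of `x` around `q`, with values in `(-π, π]`. -/
noncomputable def polarAngle (q x : EuclideanSpace ℝ (Fin 2)) : ℝ :=
  Complex.arg ⟨x 0 - q 0, x 1 - q 1⟩

theorem exists_polar_coordinates {q x : EuclideanSpace ℝ (Fin 2)} (h : x ≠ q) :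
    ∃ r : ℝ, 0 < r ∧ x 0 - q 0 = r * Real.cos (polarAngle q x) ∧
      x 1 - q 1 = r * Real.sin (polarAngle q x) := by
  refine ⟨‖(⟨x 0 - q 0, x 1 - q 1⟩ : ℂ)‖, ?_, ?_, ?_⟩
  · refine norm_pos_iff.mpr fun h0 => h ?_
    have h1 := congrArg Complex.re h0
    have h2 := congrArg Complex.im h0
    simp only [Complex.zero_re, Complex.zero_im] at h1 h2
    ext i
    fin_cases i
    · exact sub_eq_zero.mp h1
    · exact sub_eq_zero.mp h2
  · exact (Complex.norm_mul_cos_arg ⟨x 0 - q 0, x 1 - q 1⟩).symm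
  · exact (Complex.norm_mul_sin_arg ⟨x 0 - q 0, x 1 - q 1⟩).symm

theorem collinear_of_polarAngle_eq {q x y : EuclideanSpace ℝ (Fin 2)} (hx : x ≠ q) (hy : y ≠ q)
    (h : polarAngle q x = polarAngle q y) :
    Collinear ℝ ({q, x, y} : Set (EuclideanSpace ℝ (Fin 2))) := by
  obtain ⟨r, hr, hx0, hx1⟩ := exists_polar_coordinates hx
  obtain ⟨r', hr', hy0, hy1⟩ := exists_polar_coordinates hy
  rw [collinear_iff_of_mem (p₀ := q) (by simp)]
  refine ⟨x - q, fun p hp => ?_⟩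
  rcases hp with rfl | rfl | rfl
  · exact ⟨0, by simp⟩
  · exact ⟨1, by simp⟩
  · refine ⟨r' / r, ?_⟩
    ext i
    fin_cases i
    · simp only [Fin.zero_eta, vadd_eq_add, PiLp.add_apply, PiLp.smul_apply, PiLp.sub_apply,
        smul_eq_mul]
      rw [hx0, h, ← sub_eq_iff_eq_add, hy0]
      field_simp
    · simp only [Fin.mk_one, vadd_eq_add, PiLp.add_apply, PiLp.smul_apply, PiLp.sub_apply,
        smul_eq_mul]
      rw [hx1, h, ← sub_eq_iff_eq_add, hy1]
      field_simp

/-- A closed half-plane bounded by a line through `q` contains at least as many points as the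
Tukey depth of `q`; the half-plane is described by the direction `μ` of its inner normal. -/
theorem tukeyDepth_le_card_filter_cos {P : Finset (EuclideanSpace ℝ (Fin 2))}
    {q : EuclideanSpace ℝ (Fin 2)} (hq : q ∉ P) (μ : ℝ) :
    tukeyDepth (P : Set (EuclideanSpace ℝ (Fin 2))) q ≤
      (P.filter fun x => 0 ≤ Real.cos (polarAngle q x - μ)).card := by
  set v : EuclideanSpace ℝ (Fin 2) := !₂[-Real.cos μ, -Real.sin μ] with hv
  refine Nat.sInf_le ⟨v, ⟪v, q⟫, fun h0 => ?_, le_rfl, ?_⟩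
  · have h1 : v 0 = 0 := by rw [h0]; rfl
    have h2 : v 1 = 0 := by rw [h0]; rfl
    simp only [hv, PiLp.toLp_apply, Matrix.cons_val_zero, Matrix.cons_val_one] at h1 h2
    nlinarith [Real.sin_sq_add_cos_sq μ]
  · rw [← Set.ncard_coe_finset]
    congr 1
    ext x
    simp only [Set.mem_inter_iff, Finset.mem_coe, Set.mem_ofPred_eq, Finset.coe_filter]
    refine and_congr_right fun hx => ?_
    obtain ⟨r, hr, hx0, hx1⟩ := exists_polar_coordinates (q := q) (x := x)
      (ne_of_mem_of_not_mem hx hq)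
    have key : ⟪v, q⟫ - ⟪v, x⟫ = r * Real.cos (polarAngle q x - μ) := by
      rw [Real.cos_sub]
      simp only [hv, PiLp.inner_apply, Fin.sum_univ_two, RCLike.inner_apply, conj_trivial,
        Matrix.cons_val_zero, Matrix.cons_val_one]
      linear_combination Real.cos μ * hx0 + Real.sin μ * hx1
    rw [← sub_nonneg, key, mul_nonneg_iff_of_pos_left hr]

theorem exists_strictMono_enumeration {α : Type*} (P : Finset α) (f : α → ℝ)
    (hf : Set.InjOn f P) {n : ℕ} (hP : P.card = n) :
    ∃ p : Fin n → α, (∀ i, p i ∈ P) ∧ StrictMono (f ∘ p) := by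
  have hcard : (P.image f).card = n := by rw [Finset.card_image_of_injOn hf, hP]
  have h : ∀ i, ∃ x ∈ P, f x = (P.image f).orderEmbOfFin hcard i := fun i =>
    Finset.mem_image.mp ((P.image f).orderEmbOfFin_mem hcard i)
  choose p hp hfp using h
  refine ⟨p, hp, fun i j hij => ?_⟩
  simp only [Function.comp_apply, hfp]
  exact ((P.image f).orderEmbOfFin hcard).strictMono hij

/-- If every closed half-plane contains more than `s` of the directions `t i`, then two directions
with fewer than `s + 1` others between them span an angle of at most `π`. -/
theorem angle_sub_le_pi {n s : ℕ} {t : Fin n → ℝ} (ht : Monotone t)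
    (hlow : ∀ i, -Real.pi < t i) (hup : ∀ i, t i ≤ Real.pi)
    (hdepth : ∀ μ, s < (Finset.univ.filter fun i => 0 ≤ Real.cos (t i - μ)).card)
    {i j : Fin n} (hij : (j : ℕ) ≤ i + s + 1) : t j - t i ≤ Real.pi := by
  by_contra! hgap
  have hsub : (Finset.univ.filter fun k => 0 ≤ Real.cos (t k - (t i + t j) / 2)) ⊆
      Finset.Ioo i j := by
    intro k hk
    simp only [Finset.mem_filter, Finset.mem_univ, true_and] at hk
    have := hlow k; have := hup k; have := hlow i; have := hup j
    rw [Finset.mem_Ioo]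
    by_contra hnot
    refine hk.not_gt ?_
    by_cases hki : k ≤ i
    · have := ht hki
      rw [← Real.cos_neg]
      exact Real.cos_neg_of_pi_div_two_lt_of_lt (by linarith) (by linarith)
    · have := ht (not_lt.mp fun h => hnot ⟨not_le.mp hki, h⟩)
      exact Real.cos_neg_of_pi_div_two_lt_of_lt (by linarith) (by linarith)
  have h1 := hdepth ((t i + t j) / 2)
  have h2 := Finset.card_le_card hsub
  rw [Fin.card_Ioo] at h2
  omega

/-- If every closed half-plane contains more than `s` of the directions `t i`, then two directions
with fewer than `s + 1` others outside of them span an angle of at least `π`. -/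
theorem pi_le_angle_sub {n s : ℕ} {t : Fin n → ℝ} (ht : Monotone t)
    (hdepth : ∀ μ, s < (Finset.univ.filter fun i => 0 ≤ Real.cos (t i - μ)).card)
    {i j : Fin n} (hij : n + i ≤ j + s + 1) : Real.pi ≤ t j - t i := by
  by_contra! hgap
  have hsub : (Finset.univ.filter fun k =>
      0 ≤ Real.cos (t k - ((t i + t j) / 2 + Real.pi))) ⊆ (Finset.Icc i j)ᶜ := by
    intro k hk
    simp only [Finset.mem_filter, Finset.mem_univ, true_and] at hk
    rw [Finset.mem_compl, Finset.mem_Icc]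
    rintro ⟨hik, hkj⟩
    have := ht hik; have := ht hkj
    rw [← sub_sub, Real.cos_sub_pi] at hk
    have : 0 < Real.cos (t k - (t i + t j) / 2) :=
      Real.cos_pos_of_mem_Ioo ⟨by linarith, by linarith⟩
    linarith
  have h1 := hdepth ((t i + t j) / 2 + Real.pi)
  have h2 := Finset.card_le_card hsub
  rw [Finset.card_compl, Fintype.card_fin, Fin.card_Icc] at h2
  omega

theorem mem_convexHull_triple_of_weights {E : Type*} [AddCommGroup E] [Module ℝ E]
    {a b c q : E} {α β γ : ℝ} (hα : 0 ≤ α) (hβ : 0 ≤ β) (hγ : 0 ≤ γ) (hpos : 0 < α + β + γ)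
    (h : α • a + β • b + γ • c = (α + β + γ) • q) : q ∈ convexHull ℝ ({a, b, c} : Set E) := by
  have hmem := (convex_convexHull ℝ ({a, b, c} : Set E)).centerMass_mem
    (t := Finset.univ) (w := ![α, β, γ]) (z := ![a, b, c])
    (by intro i _; fin_cases i <;> assumption)
    (by simpa [Fin.sum_univ_three] using hpos)
    (by intro i _; apply subset_convexHull; fin_cases i <;> simp)
  simpa [Finset.centerMass, Fin.sum_univ_three, h, smul_smul, inv_mul_cancel₀ hpos.ne'] using hmem

/-- A triangle whose vertices, seen from `q`, have consecutive angular gaps at most `π`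
contains `q`. -/
theorem mem_convexHull_triple_of_polarAngle {q a b c : EuclideanSpace ℝ (Fin 2)}
    (ha : a ≠ q) (hb : b ≠ q) (hc : c ≠ q)
    (hab : polarAngle q a < polarAngle q b) (hbc : polarAngle q b < polarAngle q c)
    (hab' : polarAngle q b - polarAngle q a ≤ Real.pi)
    (hbc' : polarAngle q c - polarAngle q b ≤ Real.pi)
    (hac : Real.pi ≤ polarAngle q c - polarAngle q a) :
    q ∈ convexHull ℝ ({a, b, c} : Set (EuclideanSpace ℝ (Fin 2))) := by
  have hac' : polarAngle q c - polarAngle q a < 2 * Real.pi := by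
    have h1 : -Real.pi < polarAngle q a := Complex.neg_pi_lt_arg _
    have h2 : polarAngle q c ≤ Real.pi := Complex.arg_le_pi _
    linarith
  obtain ⟨r, hr, ha0, ha1⟩ := exists_polar_coordinates ha
  obtain ⟨r', hr', hb0, hb1⟩ := exists_polar_coordinates hb
  obtain ⟨r'', hr'', hc0, hc1⟩ := exists_polar_coordinates hc
  have hα := Real.sin_nonneg_of_nonneg_of_le_pi (sub_pos.mpr hbc).le hbc'
  have hγ := Real.sin_nonneg_of_nonneg_of_le_pi (sub_pos.mpr hab).le hab'
  have hβ : 0 ≤ Real.sin (polarAngle q a - polarAngle q c) := by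
    rw [← Real.sin_add_two_pi]
    exact Real.sin_nonneg_of_nonneg_of_le_pi (by linarith) (by linarith)
  have hpos : 0 < Real.sin (polarAngle q c - polarAngle q b) +
      Real.sin (polarAngle q b - polarAngle q a) := by
    rcases hab'.lt_or_eq with h | h
    · have := Real.sin_pos_of_pos_of_lt_pi (sub_pos.mpr hab) h
      linarith
    · have := Real.sin_pos_of_pos_of_lt_pi (sub_pos.mpr hbc) (by linarith)
      linarith
  have hα' := mul_nonneg (mul_pos hr' hr'').le hα
  have hβ' := mul_nonneg (mul_pos hr'' hr).le hβ
  have hγ' := mul_nonneg (mul_pos hr hr').le hγ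
  refine mem_convexHull_triple_of_weights hα' hβ' hγ' ?_ ?_
  · refine lt_of_le_of_ne (by positivity) fun h0 => ?_
    have h1 : r' * r'' * Real.sin (polarAngle q c - polarAngle q b) = 0 := by linarith
    have h2 : r * r' * Real.sin (polarAngle q b - polarAngle q a) = 0 := by linarith
    rw [mul_eq_zero, or_iff_right (mul_pos hr' hr'').ne'] at h1
    rw [mul_eq_zero, or_iff_right (mul_pos hr hr').ne'] at h2
    linarith
  · simp only [Real.sin_sub]
    rw [sub_eq_iff_eq_add] at ha0 ha1 hb0 hb1 hc0 hc1
    ext i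
    fin_cases i
    · simp only [Fin.zero_eta, PiLp.add_apply, PiLp.smul_apply, smul_eq_mul]
      rw [ha0, hb0, hc0]
      ring
    · simp only [Fin.mk_one, PiLp.add_apply, PiLp.smul_apply, smul_eq_mul]
      rw [ha1, hb1, hc1]
      ring

/-- **Deep points in the plane.** Let `P` be a set of `n` points in the plane and `q ∉ P`
a point such that `P ∪ {q}` is in general position (no three points collinear). If the
Tukey depth of `q` with respect to `P` is strictly greater than `n/3`, then there are
`s = ⌊n/3⌋` pairwise disjoint triples of points of `P` whose convex hulls all contain `q`. -/
theorem deep_tverberg (n : ℕ)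
    (P : Finset (EuclideanSpace ℝ (Fin 2))) (hP : P.card = n)
    (q : EuclideanSpace ℝ (Fin 2)) (hq : q ∉ P)
    (hgp : ∀ x ∈ insert q (P : Set (EuclideanSpace ℝ (Fin 2))),
      ∀ y ∈ insert q (P : Set (EuclideanSpace ℝ (Fin 2))),
      ∀ z ∈ insert q (P : Set (EuclideanSpace ℝ (Fin 2))),
      x ≠ y → x ≠ z → y ≠ z →
        ¬ Collinear ℝ ({x, y, z} : Set (EuclideanSpace ℝ (Fin 2))))
    (hdepth : (n : ℝ) / 3 < (tukeyDepth (P : Set (EuclideanSpace ℝ (Fin 2))) q : ℝ)) :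
    ∃ T : Fin (n / 3) → Finset (EuclideanSpace ℝ (Fin 2)),
      (∀ i, T i ⊆ P) ∧
      (∀ i, (T i).card = 3) ∧
      (∀ i j, i ≠ j → Disjoint (T i) (T j)) ∧
      ∀ i, q ∈ convexHull ℝ (T i : Set (EuclideanSpace ℝ (Fin 2))) := by
  classical
  have hne : ∀ x ∈ P, x ≠ q := fun x hx => ne_of_mem_of_not_mem hx hq
  have hinj : Set.InjOn (polarAngle q) P := by
    intro x hx y hy hxy
    by_contra hne'
    exact hgp q (by simp) x (by simp [Finset.mem_coe.mp hx]) y (by simp [Finset.mem_coe.mp hy])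
      (hne x hx).symm (hne y hy).symm hne'
      (collinear_of_polarAngle_eq (hne x hx) (hne y hy) hxy)
  obtain ⟨p, hpP, hmono⟩ := exists_strictMono_enumeration P (polarAngle q) hinj hP
  have hpinj : Function.Injective p := hmono.injective.of_comp
  have himage : Finset.univ.image p = P := by
    refine Finset.eq_of_subset_of_card_le (fun x hx => ?_) ?_
    · obtain ⟨i, -, rfl⟩ := Finset.mem_image.mp hx
      exact hpP i
    · rw [Finset.card_image_of_injective _ hpinj, Finset.card_fin, hP]
  have hlt : n / 3 < tukeyDepth (P : Set (EuclideanSpace ℝ (Fin 2))) q := by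
    rw [div_lt_iff₀ (by norm_num)] at hdepth
    have : n < tukeyDepth (P : Set (EuclideanSpace ℝ (Fin 2))) q * 3 := by exact_mod_cast hdepth
    omega
  have hcount : ∀ μ, n / 3 <
      (Finset.univ.filter fun i => 0 ≤ Real.cos ((polarAngle q ∘ p) i - μ)).card := by
    intro μ
    have h := tukeyDepth_le_card_filter_cos hq μ
    rw [← himage, Finset.filter_image, Finset.card_image_of_injective _ hpinj, himage] at h
    exact hlt.trans_le h
  have hlow : ∀ i, -Real.pi < (polarAngle q ∘ p) i := fun i => Complex.neg_pi_lt_arg _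
  have hup : ∀ i, (polarAngle q ∘ p) i ≤ Real.pi := fun i => Complex.arg_le_pi _
  let e : Fin (n / 3) → Fin 3 → Fin n := fun i k =>
    ⟨i + k * ((n + 1) / 3), by
      have := i.isLt
      fin_cases k <;> simp <;> omega⟩
  have he : ∀ i j k l, e i k = e j l → i = j ∧ k = l := by
    intro i j k l h
    have h' := congrArg Fin.val h
    have := i.isLt; have := j.isLt
    fin_cases k <;> fin_cases l <;> simp [e] at h' <;> simp [Fin.ext_iff] <;> omega
  refine ⟨fun i => {p (e i 0), p (e i 1), p (e i 2)}, fun i => ?_, fun i => ?_,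
    fun i j hij => ?_, fun i => ?_⟩
  · intro x hx
    simp only [Finset.mem_insert, Finset.mem_singleton] at hx
    rcases hx with rfl | rfl | rfl <;> exact hpP _
  · refine Finset.card_eq_three.mpr ⟨_, _, _, ?_, ?_, ?_, rfl⟩ <;>
      exact fun h => absurd (he _ _ _ _ (hpinj h)).2 (by decide)
  · rw [Finset.disjoint_left]
    intro x hx hx'
    simp only [Finset.mem_insert, Finset.mem_singleton] at hx hx'
    rcases hx with rfl | rfl | rfl <;> rcases hx' with h | h | h <;>
      exact hij (he _ _ _ _ (hpinj h)).1
  · have hi := i.isLt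
    simp only [Finset.coe_insert, Finset.coe_singleton]
    refine mem_convexHull_triple_of_polarAngle (hne _ (hpP _)) (hne _ (hpP _)) (hne _ (hpP _))
      (hmono ?_) (hmono ?_) (angle_sub_le_pi hmono.monotone hlow hup hcount ?_)
      (angle_sub_le_pi hmono.monotone hlow hup hcount ?_)
      (pi_le_angle_sub hmono.monotone hcount ?_) <;>
    simp [e, Fin.lt_def] <;> omega
end

section
/- Let P be a set of n points in the plane ℝ² and let q ∈ ℝ² be a point with q ∉ P such that P ∪ {q} is in general position (no three of its points are collinear). Suppose the Tukey depth k of q with respect to P satisfies k ≤ n/3. Then the Tverberg depth of q with respect to P equals k; that is, the maximum number m such that there exist m pairwise disjoint subsets of P, each of size at most 3, whose convex hulls all contain q, is exactly k. -/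
open scoped RealInnerProductSpace

theorem inner_plane (v w : EuclideanSpace ℝ (Fin 2)) : ⟪v, w⟫ = v 0 * w 0 + v 1 * w 1 := by
  simp [PiLp.inner_apply, Fin.sum_univ_two, mul_comm]

/-- If every point of a finite planar set `Q` lies in one of the closed half-planes
`⟪v a, x - q⟫ ≤ 0` with `a ∈ Q`, then three of these half-planes already cover `Q`. -/
theorem exists_three_halfplanes_cover (q : EuclideanSpace ℝ (Fin 2))
    (Q : Finset (EuclideanSpace ℝ (Fin 2))) (hQ : Q.Nonempty)
    (v : EuclideanSpace ℝ (Fin 2) → EuclideanSpace ℝ (Fin 2))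
    (hv : ∀ x ∈ Q, ⟪v x, x - q⟫ ≤ 0) :
    ∃ a ∈ Q, ∃ b ∈ Q, ∃ c ∈ Q, ∀ x ∈ Q,
      ⟪v a, x - q⟫ ≤ 0 ∨ ⟪v b, x - q⟫ ≤ 0 ∨ ⟪v c, x - q⟫ ≤ 0 := by
  by_contra! h
  obtain ⟨y, hy⟩ : ∃ y, ∀ a ∈ Q, 0 < ⟪v a, y⟫ := by
    have key : (⋂ a ∈ Q, {y : EuclideanSpace ℝ (Fin 2) | 0 < ⟪v a, y⟫}).Nonempty := by
      refine Convex.helly_theorem' (𝕜 := ℝ) (fun a _ ↦ ?_) (fun I hI hcard ↦ ?_)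
      · exact convex_halfSpace_gt (innerₗ _ (v a)).isLinear 0
      · obtain ⟨d, hd⟩ := hQ
        obtain ⟨a, b, c, ha, hb, hc, hIabc⟩ : ∃ a b c, a ∈ Q ∧ b ∈ Q ∧ c ∈ Q ∧
            ∀ x ∈ I, x = a ∨ x = b ∨ x = c := by
          have hle : I.card ≤ 3 := by simpa using hcard
          interval_cases hc : I.card
          · rw [Finset.card_eq_zero] at hc
            exact ⟨d, d, d, hd, hd, hd, by simp [hc]⟩
          · obtain ⟨a, rfl⟩ := Finset.card_eq_one.1 hc
            have ha : a ∈ Q := hI (by simp)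
            exact ⟨a, a, a, ha, ha, ha, by simp⟩
          · obtain ⟨a, b, -, rfl⟩ := Finset.card_eq_two.1 hc
            exact ⟨a, b, b, hI (by simp), hI (by simp), hI (by simp), by simp⟩
          · obtain ⟨a, b, c, -, -, -, rfl⟩ := Finset.card_eq_three.1 hc
            exact ⟨a, b, c, hI (by simp), hI (by simp), hI (by simp), by simp⟩
        obtain ⟨x, -, h1, h2, h3⟩ := h a ha b hb c hc
        refine ⟨x - q, ?_⟩
        simp only [Set.mem_iInter, Set.mem_ofPred_eq]
        rintro i hi
        rcases hIabc i hi with rfl | rfl | rfl <;> assumption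
    obtain ⟨y, hy⟩ := key
    exact ⟨y, by simpa using hy⟩
  set s : EuclideanSpace ℝ (Fin 2) → ℝ := fun a ↦ (v a 1 * y 0 - v a 0 * y 1) / ⟪v a, y⟫ with hs
  obtain ⟨a, ha, hamin⟩ := Q.exists_min_image s hQ
  obtain ⟨b, hb, hbmax⟩ := Q.exists_max_image s hQ
  obtain ⟨x, hx, hxa, hxb, -⟩ := h a ha b hb b hb
  set Y := ⟪y, x - q⟫
  set C := y 0 * (x - q) 1 - y 1 * (x - q) 0
  have decomp : ∀ c ∈ Q, (y 0 ^ 2 + y 1 ^ 2) * ⟪v c, x - q⟫ = ⟪v c, y⟫ * (Y + s c * C) := by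
    intro c hc
    have hne := (hy c hc).ne'
    have : ⟪v c, y⟫ * (Y + s c * C) = ⟪v c, y⟫ * Y + (v c 1 * y 0 - v c 0 * y 1) * C := by
      simp only [hs]; field_simp
    rw [this]
    simp only [Y, C, inner_plane]
    ring
  have hy2 : 0 < y 0 ^ 2 + y 1 ^ 2 := by
    by_contra! hle
    have h0 : y 0 = 0 := by nlinarith [sq_nonneg (y 0), sq_nonneg (y 1)]
    have h1 : y 1 = 0 := by nlinarith [sq_nonneg (y 0), sq_nonneg (y 1)]
    have := hy a ha
    rw [inner_plane, h0, h1] at this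
    simp at this
  have hpos : ∀ c ∈ Q, 0 < ⟪v c, x - q⟫ → 0 < Y + s c * C := fun c hc h' ↦
    pos_of_mul_pos_right (decomp c hc ▸ mul_pos hy2 h') (hy c hc).le
  have hxx : 0 < ⟪v x, y⟫ * (Y + s x * C) := by
    refine mul_pos (hy x hx) ?_
    rcases le_total 0 C with hC | hC
    · linarith [hpos a ha hxa, mul_le_mul_of_nonneg_right (hamin x hx) hC]
    · linarith [hpos b hb hxb, mul_le_mul_of_nonpos_right (hbmax x hx) hC]
  rw [← decomp x hx] at hxx
  exact absurd (pos_of_mul_pos_right hxx hy2.le) (hv x hx).not_gt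

/-- A finite planar set of at least `3 * k` points in which every closed half-plane bounded by a
line through `q` contains at least `k` points has a subset of exactly `3 * k` points with the same
property. -/
theorem exists_subset_card_eq_three_mul (q : EuclideanSpace ℝ (Fin 2)) (k : ℕ)
    (P : Finset (EuclideanSpace ℝ (Fin 2))) (hcard : 3 * k ≤ P.card)
    (hP : ∀ v : EuclideanSpace ℝ (Fin 2), v ≠ 0 → k ≤ (P.filter fun x ↦ ⟪v, x - q⟫ ≤ 0).card) :
    ∃ Q ⊆ P, Q.card = 3 * k ∧
      ∀ v : EuclideanSpace ℝ (Fin 2), v ≠ 0 → k ≤ (Q.filter fun x ↦ ⟪v, x - q⟫ ≤ 0).card := by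
  classical
  induction P using Finset.strongInduction with
  | H P ih =>
    rcases hcard.eq_or_lt with heq | hlt
    · exact ⟨P, subset_rfl, heq.symm, hP⟩
    by_cases hx : ∃ x ∈ P, ∀ v : EuclideanSpace ℝ (Fin 2), v ≠ 0 →
        k ≤ ((P.erase x).filter fun x ↦ ⟪v, x - q⟫ ≤ 0).card
    · obtain ⟨x, hxP, hx⟩ := hx
      obtain ⟨Q, hQ, h⟩ := ih _ (Finset.erase_ssubset hxP)
        (by rw [Finset.card_erase_of_mem hxP]; lia) hx
      exact ⟨Q, hQ.trans (Finset.erase_subset _ _), h⟩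
    push Not at hx
    choose! v hv0 hv using hx
    have hmem : ∀ x ∈ P, ⟪v x, x - q⟫ ≤ 0 := by
      intro x hxP
      by_contra hcon
      have := hv x hxP
      rw [Finset.filter_erase, Finset.erase_eq_of_notMem (by simp [hcon])] at this
      exact absurd (hP _ (hv0 x hxP)) this.not_ge
    have hle : ∀ x ∈ P, (P.filter fun y ↦ ⟪v x, y - q⟫ ≤ 0).card ≤ k := by
      intro x hxP
      have := hv x hxP
      rw [Finset.filter_erase, Finset.card_erase_of_mem (by simp [hxP, hmem x hxP])] at this
      exact Nat.le_of_pred_lt this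
    obtain ⟨a, ha, b, hb, c, hc, h⟩ := exists_three_halfplanes_cover q P
      (Finset.card_pos.1 (by lia)) v hmem
    have hsub : P ⊆ (P.filter fun y ↦ ⟪v a, y - q⟫ ≤ 0) ∪ ((P.filter fun y ↦ ⟪v b, y - q⟫ ≤ 0) ∪
        (P.filter fun y ↦ ⟪v c, y - q⟫ ≤ 0)) := by
      intro x hxP
      simpa [hxP] using h x hxP
    have h1 := Finset.card_le_card hsub
    have h2 := Finset.card_union_le (P.filter fun y ↦ ⟪v a, y - q⟫ ≤ 0)
      ((P.filter fun y ↦ ⟪v b, y - q⟫ ≤ 0) ∪ (P.filter fun y ↦ ⟪v c, y - q⟫ ≤ 0))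
    have h3 := Finset.card_union_le (P.filter fun y ↦ ⟪v b, y - q⟫ ≤ 0)
      (P.filter fun y ↦ ⟪v c, y - q⟫ ≤ 0)
    linarith [hle a ha, hle b hb, hle c hc]

theorem mem_convexHull_triple_of_smul_eq {E : Type*} [AddCommGroup E] [Module ℝ E] {q x y z : E}
    {a b c : ℝ} (ha : 0 ≤ a) (hb : 0 ≤ b) (hc : 0 ≤ c) (hpos : 0 < a + b + c)
    (h : a • x + b • y + c • z = (a + b + c) • q) : q ∈ convexHull ℝ ({x, y, z} : Set E) := by
  have key := (convex_convexHull ℝ ({x, y, z} : Set E)).sum_mem (t := Finset.univ)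
    (w := ![a / (a + b + c), b / (a + b + c), c / (a + b + c)]) (z := ![x, y, z])
    (by intro i _; fin_cases i <;> simp <;> positivity)
    (by simp [Fin.sum_univ_three]; field_simp)
    (by intro i _; fin_cases i <;> exact subset_convexHull ℝ _ (by simp))
  convert! key using 1
  rw [← inv_smul_smul₀ hpos.ne' q, ← h]
  simp [Fin.sum_univ_three, smul_smul, div_eq_inv_mul]

/-- Points seen from `q` under three angles that do not leave a gap larger than `π` contain `q` in
their convex hull. -/
theorem mem_convexHull_triple_of_angles {q x y z : EuclideanSpace ℝ (Fin 2)} {a b c α β γ : ℝ}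
    (ha : 0 < a) (hb : 0 < b) (hc : 0 < c)
    (hx : x - q = !₂[a * Real.cos α, a * Real.sin α])
    (hy : y - q = !₂[b * Real.cos β, b * Real.sin β])
    (hz : z - q = !₂[c * Real.cos γ, c * Real.sin γ])
    (hαβ : α < β) (hβγ : β < γ) (h₁ : β - α ≤ Real.pi) (h₂ : γ - β ≤ Real.pi)
    (h₃ : Real.pi ≤ γ - α) (h₄ : γ - α < 2 * Real.pi) :
    q ∈ convexHull ℝ ({x, y, z} : Set (EuclideanSpace ℝ (Fin 2))) := by
  have s₁ : 0 ≤ Real.sin (γ - β) := Real.sin_nonneg_of_nonneg_of_le_pi (by linarith) h₂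
  have s₂ : 0 ≤ Real.sin (γ - α - Real.pi) :=
    Real.sin_nonneg_of_nonneg_of_le_pi (by linarith) (by linarith)
  have s₃ : 0 ≤ Real.sin (β - α) := Real.sin_nonneg_of_nonneg_of_le_pi (by linarith) h₁
  have hpos : 0 < Real.sin (γ - β) / a + Real.sin (γ - α - Real.pi) / b + Real.sin (β - α) / c := by
    rcases h₁.lt_or_eq with h | h
    · have := Real.sin_pos_of_pos_of_lt_pi (by linarith) h
      positivity
    · have := Real.sin_pos_of_pos_of_lt_pi (show 0 < γ - β by linarith) (by linarith)
      positivity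
  refine mem_convexHull_triple_of_smul_eq (by positivity) (by positivity) (by positivity) hpos ?_
  obtain rfl : x = q + !₂[a * Real.cos α, a * Real.sin α] := by rw [← hx]; abel
  obtain rfl : y = q + !₂[b * Real.cos β, b * Real.sin β] := by rw [← hy]; abel
  obtain rfl : z = q + !₂[c * Real.cos γ, c * Real.sin γ] := by rw [← hz]; abel
  rw [Real.sin_sub_pi, Real.sin_sub, Real.sin_sub, Real.sin_sub]
  ext i
  fin_cases i <;> simp <;> field_simp <;> ring

/-- Birch's selection: if a set of `3 * k` points has pairwise distinct angles around `q` and every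
closed half-plane bounded by a line through `q` contains at least `k` of the points, then joining
every `k`-th point in angular order yields `k` disjoint triangles containing `q`. -/
theorem exists_disjoint_triangles (q : EuclideanSpace ℝ (Fin 2)) (k : ℕ)
    (Q : Finset (EuclideanSpace ℝ (Fin 2))) (hcard : Q.card = 3 * k)
    (hQ : ∀ v : EuclideanSpace ℝ (Fin 2), v ≠ 0 → k ≤ (Q.filter fun x ↦ ⟪v, x - q⟫ ≤ 0).card)
    (r θ : EuclideanSpace ℝ (Fin 2) → ℝ) (hr : ∀ x ∈ Q, 0 < r x)
    (hrθ : ∀ x ∈ Q, x - q = !₂[r x * Real.cos (θ x), r x * Real.sin (θ x)])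
    (hθ : ∀ x ∈ Q, θ x ∈ Set.Ioc (-Real.pi) Real.pi) (hinj : Set.InjOn θ Q) :
    ∃ T : Fin k → Finset (EuclideanSpace ℝ (Fin 2)),
      (∀ i, T i ⊆ Q) ∧ (∀ i, (T i).card ≤ 3) ∧ (∀ i j, i ≠ j → Disjoint (T i) (T j)) ∧
      ∀ i, q ∈ convexHull ℝ (T i : Set (EuclideanSpace ℝ (Fin 2))) := by
  classical
  have hcard' : (Q.image θ).card = 3 * k := by rw [Finset.card_image_of_injOn hinj, hcard]
  obtain ⟨p, hpQ, hmono, hsurj⟩ : ∃ p : Fin (3 * k) → EuclideanSpace ℝ (Fin 2),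
      (∀ j, p j ∈ Q) ∧ StrictMono (θ ∘ p) ∧ ∀ x ∈ Q, ∃ j, p j = x := by
    have hmem (j) := Finset.mem_image.1 ((Q.image θ).orderEmbOfFin_mem hcard' j)
    choose p hpQ hp using hmem
    refine ⟨p, hpQ, fun i j hij ↦ by simpa [hp] using hij, fun x hx ↦ ?_⟩
    obtain ⟨j, hj⟩ : θ x ∈ Set.range ((Q.image θ).orderEmbOfFin hcard') := by
      rw [Finset.range_orderEmbOfFin]
      exact Finset.mem_coe.2 (Finset.mem_image_of_mem θ hx)
    exact ⟨j, hinj (hpQ j) hx ((hp j).trans hj)⟩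
  have hpinj : Function.Injective p := hmono.injective.of_comp
  have hcount (φ : ℝ) (J : Finset (Fin (3 * k)))
      (hJ : ∀ j ∉ J, Real.sin (θ (p j) - φ) < 0) : k ≤ J.card := by
    have hv : !₂[Real.sin φ, -Real.cos φ] ≠ (0 : EuclideanSpace ℝ (Fin 2)) := by
      intro h
      have h0 : Real.sin φ = 0 := by simpa using congrArg (fun w ↦ w 0) h
      have h1 : Real.cos φ = 0 := by simpa using congrArg (fun w ↦ w 1) h
      simpa [h0, h1] using Real.sin_sq_add_cos_sq φ
    refine (hQ _ hv).trans ((Finset.card_le_card (t := J.image p) ?_).trans Finset.card_image_le)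
    intro x hx
    obtain ⟨hxQ, hx⟩ := Finset.mem_filter.1 hx
    obtain ⟨j, rfl⟩ := hsurj x hxQ
    by_contra hcon
    have hneg := hJ j fun hj ↦ hcon (Finset.mem_image_of_mem p hj)
    rw [hrθ _ hxQ, inner_plane] at hx
    rw [Real.sin_sub] at hneg
    simp only [Matrix.cons_val_zero, Matrix.cons_val_one] at hx
    nlinarith [mul_neg_of_pos_of_neg (hr _ hxQ) hneg]
  have hgap (i j : Fin (3 * k)) (hij : (j : ℕ) = i + k) : θ (p j) - θ (p i) ≤ Real.pi := by
    by_contra! hlt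
    have hk : k ≤ (Finset.Ioo i j).card := by
      refine hcount ((θ (p i) + θ (p j) - Real.pi) / 2) _ fun l hl ↦ ?_
      have hi := hθ _ (hpQ i)
      have hj := hθ _ (hpQ j)
      have hl' := hθ _ (hpQ l)
      simp only [Set.mem_Ioc] at hi hj hl'
      rw [Finset.mem_Ioo, not_and_or, not_lt, not_lt] at hl
      rcases hl with hl | hl
      · have : θ (p l) ≤ θ (p i) := hmono.monotone hl
        exact Real.sin_neg_of_neg_of_neg_pi_lt (by linarith) (by linarith)
      · have : θ (p j) ≤ θ (p l) := hmono.monotone hl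
        rw [← Real.sin_sub_two_pi]
        exact Real.sin_neg_of_neg_of_neg_pi_lt (by linarith) (by linarith)
    rw [Fin.card_Ioo] at hk
    lia
  have hspan (i j : Fin (3 * k)) (hij : (j : ℕ) = i + 2 * k) :
      Real.pi ≤ θ (p j) - θ (p i) := by
    by_contra! hlt
    have hk : k ≤ (Finset.Iio i ∪ Finset.Ioi j).card := by
      refine hcount ((θ (p i) + θ (p j) + Real.pi) / 2) _ fun l hl ↦ ?_
      simp only [Finset.mem_union, Finset.mem_Iio, Finset.mem_Ioi, not_or, not_lt] at hl
      have h₁ : θ (p i) ≤ θ (p l) := hmono.monotone hl.1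
      have h₂ : θ (p l) ≤ θ (p j) := hmono.monotone hl.2
      exact Real.sin_neg_of_neg_of_neg_pi_lt (by linarith) (by linarith)
    have hle := hk.trans (Finset.card_union_le _ _)
    rw [Fin.card_Iio, Fin.card_Ioi] at hle
    lia
  let e (i : Fin k) (m : Fin 3) : Fin (3 * k) := ⟨i + m * k, by
    have hm : (m : ℕ) * k ≤ 2 * k := Nat.mul_le_mul_right k (by lia)
    lia⟩
  refine ⟨fun i ↦ {p (e i 0), p (e i 1), p (e i 2)}, fun i ↦ ?_, fun i ↦ Finset.card_le_three,
    fun i j hij ↦ ?_, fun i ↦ ?_⟩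
  · simp [Finset.insert_subset_iff, hpQ]
  · have hne : (i : ℕ) ≠ j := Fin.val_ne_of_ne hij
    simp [Finset.disjoint_left, hpinj.eq_iff, e]
    lia
  · have hk : 0 < k := i.pos
    have h01 : e i 0 < e i 1 := by simp [e, hk]
    have h12 : e i 1 < e i 2 := by simp [e, Fin.lt_def]; lia
    have h0 := hθ _ (hpQ (e i 0))
    have h2 := hθ _ (hpQ (e i 2))
    simp only [Set.mem_Ioc] at h0 h2
    rw [Finset.coe_insert, Finset.coe_insert, Finset.coe_singleton]
    exact mem_convexHull_triple_of_angles (hr _ (hpQ _)) (hr _ (hpQ _)) (hr _ (hpQ _))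
      (hrθ _ (hpQ _)) (hrθ _ (hpQ _)) (hrθ _ (hpQ _)) (hmono h01) (hmono h12)
      (hgap _ _ (by simp [e])) (hgap _ _ (by simp [e]; lia)) (hspan _ _ (by simp [e]))
      (by linarith)

/-- **Reay's theorem in the plane.** Let `P` be a set of `n` points in the plane and
`q ∉ P` a point such that `P ∪ {q}` is in general position (no three points collinear).
If the Tukey depth `k` of `q` with respect to `P` satisfies `k ≤ n/3`, then the Tverberg
depth of `q` equals `k`: the greatest `m` for which there exist `m` pairwise disjoint
subsets of `P`, each of at most `3` points, whose convex hulls all contain `q`, is `k`. -/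
theorem reay_plane (n k : ℕ)
    (P : Finset (EuclideanSpace ℝ (Fin 2))) (hP : P.card = n)
    (q : EuclideanSpace ℝ (Fin 2)) (hq : q ∉ P)
    (hgp : ∀ x ∈ insert q (P : Set (EuclideanSpace ℝ (Fin 2))),
      ∀ y ∈ insert q (P : Set (EuclideanSpace ℝ (Fin 2))),
      ∀ z ∈ insert q (P : Set (EuclideanSpace ℝ (Fin 2))),
      x ≠ y → x ≠ z → y ≠ z →
        ¬ Collinear ℝ ({x, y, z} : Set (EuclideanSpace ℝ (Fin 2))))
    (hdepth : tukeyDepth (P : Set (EuclideanSpace ℝ (Fin 2))) q = k)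
    (hk : 3 * k ≤ n) :
    IsGreatest { m : ℕ | ∃ T : Fin m → Finset (EuclideanSpace ℝ (Fin 2)),
      (∀ i, T i ⊆ P) ∧
      (∀ i, (T i).card ≤ 3) ∧
      (∀ i j, i ≠ j → Disjoint (T i) (T j)) ∧
      ∀ i, q ∈ convexHull ℝ (T i : Set (EuclideanSpace ℝ (Fin 2))) } k := by
  refine ⟨?_, ?_⟩
  · have hdeep : ∀ v : EuclideanSpace ℝ (Fin 2), v ≠ 0 →
        k ≤ (P.filter fun x ↦ ⟪v, x - q⟫ ≤ 0).card := by
      intro v hv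
      rw [← hdepth]
      refine Nat.sInf_le ⟨v, ⟪v, q⟫, hv, le_rfl, ?_⟩
      rw [← Set.ncard_coe_finset]
      congr 1
      ext x
      simp [inner_sub_right]
    obtain ⟨Q, hQP, hcard, hQ⟩ := exists_subset_card_eq_three_mul q k P (hP ▸ hk) hdeep
    let ζ (x : EuclideanSpace ℝ (Fin 2)) : ℂ := ⟨(x - q) 0, (x - q) 1⟩
    have hpolar (x) : x - q =
        !₂[‖ζ x‖ * Real.cos (ζ x).arg, ‖ζ x‖ * Real.sin (ζ x).arg] := by
      rw [Complex.norm_mul_cos_arg, Complex.norm_mul_sin_arg]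
      ext i
      fin_cases i <;> rfl
    have hpos : ∀ x ∈ P, 0 < ‖ζ x‖ := by
      intro x hx
      refine norm_pos_iff.2 fun h0 ↦ hq ?_
      have := hpolar x
      simp only [h0, norm_zero, zero_mul] at this
      have hxq : x - q = 0 := by
        rw [this]
        ext i
        fin_cases i <;> rfl
      rwa [← sub_eq_zero.1 hxq]
    have hinj : Set.InjOn (fun x ↦ (ζ x).arg) Q := by
      intro x hx y hy hxy
      by_contra hne
      have hxP := hQP hx
      have hyP := hQP hy
      refine hgp q (by simp) x (by simp [hxP]) y (by simp [hyP]) (ne_of_mem_of_not_mem hxP hq).symm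
        (ne_of_mem_of_not_mem hyP hq).symm hne ?_
      rw [collinear_iff_of_mem (p₀ := q) (by simp)]
      have hdir (z) : z = ‖ζ z‖ • !₂[Real.cos (ζ z).arg, Real.sin (ζ z).arg] +ᵥ q := by
        rw [vadd_eq_add, ← sub_eq_iff_eq_add]
        refine (hpolar z).trans ?_
        ext i
        fin_cases i <;> simp
      refine ⟨!₂[Real.cos (ζ x).arg, Real.sin (ζ x).arg], ?_⟩
      simp only [Set.mem_insert_iff, Set.mem_singleton_iff]
      rintro z (rfl | rfl | rfl)
      · exact ⟨0, by simp⟩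
      · exact ⟨_, hdir z⟩
      · refine ⟨‖ζ z‖, ?_⟩
        rw [show (ζ x).arg = (ζ z).arg from hxy]
        exact hdir z
    obtain ⟨T, hT, h⟩ := exists_disjoint_triangles q k Q hcard hQ (fun x ↦ ‖ζ x‖)
      (fun x ↦ (ζ x).arg) (fun x hx ↦ hpos x (hQP hx)) (fun x _ ↦ hpolar x)
      (fun x _ ↦ Complex.arg_mem_Ioc _) hinj
    exact ⟨T, fun i ↦ (hT i).trans hQP, h⟩
  · rintro m ⟨T, hTP, -, hdisj, hconv⟩
    have hne : { m : ℕ | ∃ (v : EuclideanSpace ℝ (Fin 2)) (c : ℝ), v ≠ 0 ∧ ⟪v, q⟫ ≤ c ∧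
        ((P : Set (EuclideanSpace ℝ (Fin 2))) ∩ {x | ⟪v, x⟫ ≤ c}).ncard = m }.Nonempty := by
      obtain ⟨v, hv⟩ := exists_ne (0 : EuclideanSpace ℝ (Fin 2))
      exact ⟨_, v, ⟪v, q⟫, hv, le_rfl, rfl⟩
    obtain ⟨v, c, -, hqc, hncard⟩ := Nat.sInf_mem hne
    have hmeet (i : Fin m) : ∃ x ∈ T i, ⟪v, x⟫ ≤ c := by
      by_contra! hlt
      have hsub : convexHull ℝ (T i : Set (EuclideanSpace ℝ (Fin 2))) ⊆ {x | c < ⟪v, x⟫} :=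
        convexHull_min hlt (convex_halfSpace_gt (innerₗ _ v).isLinear c)
      exact absurd hqc (not_le.2 (hsub (hconv i)))
    choose x hxT hxc using hmeet
    have hxinj : Function.Injective x := by
      intro i j hij
      by_contra hne
      exact Finset.disjoint_left.1 (hdisj i j hne) (hxT i) (hij ▸ hxT j)
    rw [← hdepth, tukeyDepth, ← hncard]
    calc m = (Set.range x).ncard := by
          rw [← Set.image_univ, Set.ncard_image_of_injective _ hxinj, Set.ncard_univ, Nat.card_fin]
      _ ≤ _ := Set.ncard_le_ncard
          (Set.range_subset_iff.2 fun i ↦ Set.mem_inter (hTP i (hxT i)) (hxc i))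
          (P.finite_toSet.inter_of_left _)
end

section
/- Let d ≥ 1 and r ≥ 1. For each i = 1, …, d+2 let p_i ∈ ℝ^d and let Q_i^1, …, Q_i^r be finite subsets of ℝ^d such that p_i ∈ conv(Q_i^t) for every t, and suppose all the (d+2)·r sets Q_i^t are pairwise disjoint. Then there exist a point p ∈ ℝ^d and 2r pairwise disjoint subsets R_1, …, R_{2r} of the union ⋃_{i,t} Q_i^t, each of size at most d+1, such that p ∈ conv(R_j) for every j = 1, …, 2r. -/
/-- **Carathéodory's theorem**, cardinality form: a point of the convex hull of `s` lies in the
convex hull of at most `finrank 𝕜 E + 1` points of `s`. -/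
theorem exists_finset_card_le_finrank_succ_of_mem_convexHull {𝕜 E : Type*} [Field 𝕜]
    [LinearOrder 𝕜] [IsStrictOrderedRing 𝕜] [AddCommGroup E] [Module 𝕜 E] [FiniteDimensional 𝕜 E]
    {s : Set E} {x : E} (hx : x ∈ convexHull 𝕜 s) :
    ∃ t : Finset E, (t : Set E) ⊆ s ∧ t.card ≤ Module.finrank 𝕜 E + 1 ∧
      x ∈ convexHull 𝕜 (t : Set E) := by
  rw [convexHull_eq_union] at hx
  simp only [exists_prop, Set.mem_iUnion] at hx
  obtain ⟨t, hts, hind, hxt⟩ := hx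
  refine ⟨t, hts, ?_, hxt⟩
  simpa using hind.card_le_finrank_succ.trans
    (Nat.add_le_add_right (Submodule.finrank_le _) 1)

/-- If each `p i` with `i ∈ I` lies in the convex hull of `A i`, then the convex hull of `p '' I`
is contained in the convex hull of the union of the `A i`. -/
theorem convexHull_image_subset_convexHull_biUnion {𝕜 E ι : Type*} [Semiring 𝕜]
    [PartialOrder 𝕜] [AddCommMonoid E] [Module 𝕜 E] {p : ι → E} {A : ι → Set E} {I : Set ι}
    (h : ∀ i ∈ I, p i ∈ convexHull 𝕜 (A i)) :
    convexHull 𝕜 (p '' I) ⊆ convexHull 𝕜 (⋃ i ∈ I, A i) := by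
  refine convexHull_min ?_ (convex_convexHull 𝕜 _)
  rintro _ ⟨i, hi, rfl⟩
  exact convexHull_mono (Set.subset_biUnion_of_mem (u := A) hi) (h i hi)


/-- **Merging logs (Miller–Sheehy).** Given `d + 2` points `p i` of `ℝ^d`, each lying in
the convex hulls of `r` finite sets `Q i t` (`t = 1, …, r`), where all `(d+2)·r` sets are
pairwise disjoint, there are a point `p` and `2r` pairwise disjoint subsets `R j` of
`⋃ Q i t`, each of at most `d + 1` points, with `p ∈ conv(R j)` for every `j`. -/
theorem merge_logs (d r : ℕ) (hd : 1 ≤ d) (hr : 1 ≤ r)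
    (p : Fin (d + 2) → EuclideanSpace ℝ (Fin d))
    (Q : Fin (d + 2) → Fin r → Finset (EuclideanSpace ℝ (Fin d)))
    (hconv : ∀ i t, p i ∈ convexHull ℝ (Q i t : Set (EuclideanSpace ℝ (Fin d))))
    (hdisj : ∀ i t j s, (i, t) ≠ (j, s) → Disjoint (Q i t) (Q j s)) :
    ∃ (pt : EuclideanSpace ℝ (Fin d))
      (R : Fin (2 * r) → Finset (EuclideanSpace ℝ (Fin d))),
      (∀ j, (R j : Set (EuclideanSpace ℝ (Fin d))) ⊆
        ⋃ i, ⋃ t, (Q i t : Set (EuclideanSpace ℝ (Fin d)))) ∧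
      (∀ j, (R j).card ≤ d + 1) ∧
      (∀ j l, j ≠ l → Disjoint (R j) (R l)) ∧
      ∀ j, pt ∈ convexHull ℝ (R j : Set (EuclideanSpace ℝ (Fin d))) := by
  have hdep : ¬ AffineIndependent ℝ p := fun h => by
    have := h.card_le_finrank_succ.trans (Nat.add_le_add_right (Submodule.finrank_le _) 1)
    simp at this
  obtain ⟨I, pt, hI, hIc⟩ := Convex.radon_partition hdep
  let side : Fin 2 → Set (Fin (d + 2)) := ![I, Iᶜ]
  have hside : ∀ b, pt ∈ convexHull ℝ (p '' side b) := Fin.forall_fin_two.2 ⟨hI, hIc⟩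
  have hside_disj : ∀ b c i, i ∈ side b → i ∈ side c → b = c := by
    simp [Fin.forall_fin_two, side]
  have hmerge (b : Fin 2) (t : Fin r) := exists_finset_card_le_finrank_succ_of_mem_convexHull
    (convexHull_image_subset_convexHull_biUnion (fun i _ => hconv i t) (hside b))
  choose T hTsub hTcard hTconv using hmerge
  let e : Fin (2 * r) ≃ Fin 2 × Fin r := finProdFinEquiv.symm
  refine ⟨pt, fun j => T (e j).1 (e j).2, fun j => ?_, fun j => ?_, fun j l hjl => ?_,
    fun j => hTconv _ _⟩
  · intro x hx
    obtain ⟨i, -, hxi⟩ := Set.mem_iUnion₂.1 (hTsub _ _ hx)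
    exact Set.mem_iUnion₂.2 ⟨i, _, hxi⟩
  · simpa using hTcard (e j).1 (e j).2
  · refine Finset.disjoint_left.2 fun x hxj hxl => hjl (e.injective ?_)
    obtain ⟨i, hi, hxi⟩ := Set.mem_iUnion₂.1 (hTsub _ _ hxj)
    obtain ⟨k, hk, hxk⟩ := Set.mem_iUnion₂.1 (hTsub _ _ hxl)
    have hik : (i, (e j).2) = (k, (e l).2) := by
      by_contra hne
      exact Finset.disjoint_left.1 (hdisj _ _ _ _ hne) hxi hxk
    obtain ⟨rfl, hsnd⟩ := Prod.mk.inj hik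
    exact Prod.ext (hside_disj _ _ i hi hk) hsnd
end

section
/- Let d ≥ 1, let ℓ be a line in ℝ^d, let m ≥ 1, and let C_1, …, C_{2m} be convex subsets of ℝ^d each of which intersects ℓ. Then there exist a point q ∈ ℓ and a partition of the index set {1, …, 2m} into m pairs such that for every pair {i, j} of the partition, q ∈ conv(C_i ∪ C_j). -/
/-- An even number of points of a linear order can be paired up so that a common point, a median,
lies between the two points of each pair. -/
theorem exists_pairing_mem_uIcc {α : Type*} [LinearOrder α] {m : ℕ} (hm : 0 < m)
    (t : Fin (2 * m) → α) :
    ∃ c : α, ∃ f : Fin (2 * m) → Fin (2 * m),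
      Function.Involutive f ∧ (∀ i, f i ≠ i) ∧ ∀ i, c ∈ Set.uIcc (t i) (t (f i)) := by
  let σ := Tuple.sort t
  have hσ : Monotone (t ∘ σ) := Tuple.monotone_sort t
  let k : Fin (2 * m) := ⟨m - 1, by omega⟩
  refine ⟨t (σ k), fun i => σ (σ.symm i).rev, fun i => by simp, fun i hi => ?_, fun i => ?_⟩
  · have h := congrArg Fin.val (σ.eq_symm_apply.mpr hi)
    rw [Fin.val_rev] at h
    omega
  · obtain ⟨j, rfl⟩ := σ.surjective i
    simp only [Equiv.symm_apply_apply]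
    rcases le_or_gt j k with h | h
    · have h' : k ≤ j.rev := by
        rw [Fin.le_def] at h ⊢
        rw [Fin.val_rev]
        change (j : ℕ) ≤ m - 1 at h
        change m - 1 ≤ _
        omega
      exact Set.mem_uIcc.mpr (Or.inl ⟨hσ h, hσ h'⟩)
    · have h' : j.rev ≤ k := by
        rw [Fin.lt_def] at h
        rw [Fin.le_def, Fin.val_rev]
        change m - 1 < (j : ℕ) at h
        change _ ≤ m - 1
        omega
      exact Set.mem_uIcc.mpr (Or.inr ⟨hσ h', hσ h.le⟩)

/-- If `c` lies between `s` and `t`, and the points of a line with parameters `s` and `t` lie in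
`S` and `T`, then the point with parameter `c` lies in the convex hull of `S ∪ T`. -/
theorem add_smul_mem_convexHull_union {E : Type*} [AddCommGroup E] [Module ℝ E] {a b : E}
    {S T : Set E} {s t c : ℝ} (hs : a + s • b ∈ S) (ht : a + t • b ∈ T)
    (hc : c ∈ Set.uIcc s t) : a + c • b ∈ convexHull ℝ (S ∪ T) := by
  rw [← segment_eq_uIcc] at hc
  obtain ⟨x, y, hx, hy, hxy, rfl⟩ := hc
  refine (convex_convexHull ℝ (S ∪ T)).segment_subset
    (subset_convexHull ℝ _ (Or.inl hs)) (subset_convexHull ℝ _ (Or.inr ht))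
    ⟨x, y, hx, hy, hxy, ?_⟩
  obtain rfl : y = 1 - x := by linarith
  simp only [smul_eq_mul]
  module


/-- **Pairing convex sets along a line.** Let `ℓ = {a + t • b : t ∈ ℝ}` (with `b ≠ 0`) be a
line in `ℝ^d` and let `C_1, …, C_{2m}` be convex subsets of `ℝ^d`, each meeting `ℓ`. Then
there are a point `q ∈ ℓ` and a partition of the indices into `m` pairs (encoded by a
fixed-point-free involution `f`) such that `q ∈ conv(C_i ∪ C_{f i})` for every `i`. -/
theorem pairing_along_line (d m : ℕ) (hd : 1 ≤ d) (hm : 1 ≤ m)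
    (a b : EuclideanSpace ℝ (Fin d)) (hb : b ≠ 0)
    (C : Fin (2 * m) → Set (EuclideanSpace ℝ (Fin d)))
    (hCconv : ∀ i, Convex ℝ (C i))
    (hCmeet : ∀ i, ∃ t : ℝ, a + t • b ∈ C i) :
    ∃ q : EuclideanSpace ℝ (Fin d), (∃ t : ℝ, q = a + t • b) ∧
      ∃ f : Fin (2 * m) → Fin (2 * m),
        (∀ i, f (f i) = i) ∧ (∀ i, f i ≠ i) ∧
        ∀ i, q ∈ convexHull ℝ (C i ∪ C (f i)) := by
  choose t ht using hCmeet
  obtain ⟨c, f, hinv, hne, hc⟩ := exists_pairing_mem_uIcc hm t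
  exact ⟨a + c • b, ⟨c, rfl⟩, f, hinv, hne,
    fun i => add_smul_mem_convexHull_union (ht i) (ht (f i)) (hc i)⟩
end

section
/- Let P be a set of n points in ℝ³. Then there exist a point q ∈ ℝ³ and ⌊n/6⌋ pairwise disjoint subsets of P, each of size at most 4, such that the convex hull of each subset contains q. -/
/-- **Colorful Carathéodory theorem**, for finitely many colors and finite color classes. -/
theorem exists_zero_mem_convexHull_range_selection {E ι κ : Type*} [NormedAddCommGroup E]
    [InnerProductSpace ℝ E] [FiniteDimensional ℝ E] [Fintype ι] [Finite κ]
    (hι : Module.finrank ℝ E < Fintype.card ι) (w : ι → κ → E)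
    (hw : ∀ i, (0 : E) ∈ convexHull ℝ (Set.range (w i))) :
    ∃ c : ι → κ, (0 : E) ∈ convexHull ℝ (Set.range fun i => w i (c i)) := by
  classical
  have : Nonempty ι := Fintype.card_pos_iff.1 (by omega)
  have : Nonempty κ := by
    obtain ⟨_, k, _⟩ := convexHull_nonempty_iff.1 ⟨_, hw (Classical.arbitrary ι)⟩
    exact ⟨k⟩
  let H : (ι → κ) → Set E := fun c => convexHull ℝ (Set.range fun i => w i (c i))
  have hcomp : IsCompact (⋃ c, H c) :=
    isCompact_iUnion fun c => (Set.finite_range _).isCompact_convexHull ℝ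
  have hne : (⋃ c, H c).Nonempty :=
    Set.nonempty_iUnion.2 ⟨fun _ => Classical.arbitrary κ,
      convexHull_nonempty_iff.2 (Set.range_nonempty _)⟩
  obtain ⟨z, hz, hmin⟩ := hcomp.exists_isMinOn hne continuous_norm.continuousOn
  obtain ⟨c, hzc⟩ := Set.mem_iUnion.1 hz
  refine ⟨c, ?_⟩
  by_cases hz0 : z = 0
  · exact hz0 ▸ hzc
  exfalso
  have hzpos : 0 < inner ℝ z z := real_inner_self_pos.2 hz0
  have hinner : ∀ c', z ∈ H c' → ∀ y ∈ H c', inner ℝ z z ≤ inner ℝ z y := by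
    intro c' hz' y hy
    have hconv : Convex ℝ (H c') := convex_convexHull ℝ _
    have : Nonempty (H c') := ⟨⟨z, hz'⟩⟩
    have key : ‖(0 : E) - z‖ = ⨅ u : H c', ‖(0 : E) - u‖ := by
      refine le_antisymm (le_ciInf fun u => ?_) ?_
      · simpa using hmin (Set.mem_iUnion.2 ⟨c', u.2⟩)
      · exact ciInf_le (f := fun u : H c' => ‖(0 : E) - u‖)
          ⟨0, by rintro _ ⟨u, rfl⟩; exact norm_nonneg _⟩ ⟨z, hz'⟩
    have := (norm_eq_iInf_iff_real_inner_le_zero hconv hz').1 key y hy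
    simp only [zero_sub, inner_neg_left, inner_sub_right] at this
    linarith
  obtain ⟨τ, _, u, a, hu, hind, ha, ha1, haz⟩ := eq_pos_convex_span_of_mem_convexHull hzc
  have hge : ∀ t, inner ℝ z z ≤ inner ℝ z (u t) := fun t =>
    hinner c hzc _ (subset_convexHull ℝ _ (hu ⟨t, rfl⟩))
  have hsum : ∑ t, a t * (inner ℝ z (u t) - inner ℝ z z) = 0 := by
    have h : inner ℝ z (∑ t, a t • u t) = inner ℝ z z := by rw [haz]
    simp only [inner_sum, inner_smul_right] at h
    simp only [mul_sub, Finset.sum_sub_distrib, ← Finset.sum_mul, ha1, h, one_mul, sub_self]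
  have heq : ∀ t, inner ℝ z (u t) = inner ℝ z z := by
    intro t
    have := (Finset.sum_eq_zero_iff_of_nonneg fun t _ =>
      mul_nonneg (ha t).le (sub_nonneg.2 (hge t))).1 hsum t (Finset.mem_univ t)
    rcases mul_eq_zero.1 this with h | h
    · exact absurd h (ha t).ne'
    · exact sub_eq_zero.1 h
  have hlin : LinearIndependent ℝ u := by
    rw [Fintype.linearIndependent_iff]
    intro g hg
    have h0 : ∑ t, g t = 0 := by
      have := congrArg (inner ℝ z) hg
      simp only [inner_sum, inner_smul_right, heq, inner_zero_right, ← Finset.sum_mul] at this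
      exact (mul_eq_zero.1 this).resolve_right hzpos.ne'
    exact fun t => affineIndependent_iff.1 hind Finset.univ g h0 hg t (Finset.mem_univ t)
  have hcard := hlin.fintype_card_le_finrank
  choose g hg using fun t => hu ⟨t, rfl⟩
  have hns : ¬ Function.Surjective g := fun hs => by
    have := Fintype.card_le_of_surjective g hs
    omega
  obtain ⟨i₀, hi₀⟩ := not_forall.1 hns
  obtain ⟨k, hk⟩ : ∃ k, inner ℝ z (w i₀ k) ≤ 0 := by
    by_contra! hcon
    have hsub : convexHull ℝ (Set.range (w i₀)) ⊆ {y | 0 < inner ℝ z y} :=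
      convexHull_min (by rintro _ ⟨k, rfl⟩; exact hcon k)
        (convex_halfSpace_gt (innerSL ℝ z).toLinearMap.isLinear 0)
    simpa using hsub (hw i₀)
  have hz' : z ∈ H (Function.update c i₀ k) := by
    rw [← haz]
    refine (convex_convexHull ℝ _).sum_mem (fun t _ => (ha t).le) ha1 fun t _ =>
      subset_convexHull ℝ _ ⟨g t, ?_⟩
    have hne' : g t ≠ i₀ := fun h => hi₀ ⟨t, h⟩
    simpa [Function.update_of_ne hne'] using hg t
  have := hinner _ hz' (w i₀ k) (subset_convexHull ℝ _ ⟨i₀, by simp⟩)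
  linarith

/-- **Tverberg's theorem**, for partitions into `k + 1` parts. -/
theorem tverberg_partition {ι : Type*} [Fintype ι] {d k : ℕ} (hι : k * (d + 1) < Fintype.card ι)
    (x : ι → EuclideanSpace ℝ (Fin d)) :
    ∃ (q : EuclideanSpace ℝ (Fin d)) (c : ι → Option (Fin k)),
      ∀ j, q ∈ convexHull ℝ (x '' {i | c i = j}) := by
  classical
  let y : ι → Option (Fin d) → ℝ := fun i a => a.elim 1 (x i)
  let v : Option (Fin k) → Fin k → ℝ := fun c l => c.elim (-1) fun j => if j = l then 1 else 0
  let w : ι → Option (Fin k) → EuclideanSpace ℝ (Fin k × Option (Fin d)) :=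
    fun i c => WithLp.toLp 2 fun b => v c b.1 * y i b.2
  have hw : ∀ i, 0 ∈ convexHull ℝ (Set.range (w i)) := by
    intro i
    have h := Finset.univ.centerMass_mem_convexHull (R := ℝ) (w := fun _ : Option (Fin k) => 1)
      (z := w i) (s := Set.range (w i)) (by simp) (by simp; positivity) (by simp)
    have h0 : ∑ c, w i c = 0 := by
      ext b
      simp [w, v, Fintype.sum_option]
    simpa [Finset.centerMass, h0] using h
  obtain ⟨c, hc⟩ := exists_zero_mem_convexHull_range_selection
    (by simpa [Fintype.card_option] using hι) w hw
  rw [convexHull_range_eq_exists_affineCombination] at hc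
  obtain ⟨s, a, ha, ha1, hz⟩ := hc
  rw [affineCombination_eq_centerMass ha1, Finset.centerMass_eq_of_sum_1 _ _ ha1] at hz
  let F : Option (Fin k) → Finset ι := fun j => {i ∈ s | c i = j}
  have hF : ∀ j b, ∑ i ∈ F j, a i * y i b = ∑ i ∈ F none, a i * y i b := by
    rintro (_ | l) b
    · rfl
    have h := congrArg (fun z => z (l, b)) hz
    have hv : ∀ i, a i * (v (c i) l * y i b) =
        (if c i = some l then a i * y i b else 0) - if c i = none then a i * y i b else 0 := by
      intro i
      rcases hci : c i with _ | j
      · simp [v]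
      · by_cases hj : j = l <;> simp [v, hj]
    simp only [w, WithLp.ofLp_sum, Finset.sum_apply, PiLp.smul_apply, smul_eq_mul, hv,
      Finset.sum_sub_distrib, ← Finset.sum_filter, PiLp.zero_apply] at h
    exact sub_eq_zero.1 h
  have hmass : ∀ j, ∑ i ∈ F j, a i = ∑ i ∈ F none, a i := fun j => by
    simpa [y] using hF j none
  have hpos : 0 < ∑ i ∈ F none, a i := by
    have htot := Finset.sum_fiberwise s c a
    have hconst : ∑ j, ∑ i ∈ F j, a i = 1 := htot.trans ha1
    simp only [hmass, Finset.sum_const, nsmul_eq_mul] at hconst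
    refine lt_of_le_of_ne (Finset.sum_nonneg fun i hi => ha i (Finset.mem_filter.1 hi).1) ?_
    intro h0
    simp [← h0] at hconst
  refine ⟨(F none).centerMass a x, c, fun j => ?_⟩
  have heq : (F none).centerMass a x = (F j).centerMass a x := by
    simp only [Finset.centerMass, hmass j]
    congr 1
    ext l
    simpa [y, WithLp.ofLp_sum] using (hF j (some l)).symm
  rw [heq]
  exact (F j).centerMass_mem_convexHull (fun i hi => ha i (Finset.mem_filter.1 hi).1)
    (hmass j ▸ hpos) fun i hi => ⟨i, (Finset.mem_filter.1 hi).2, rfl⟩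

/-- **Tverberg approximation in `ℝ³`.** For any set `P` of `n` points in `ℝ³`, there are a
point `q` and `⌊n/6⌋` pairwise disjoint subsets of `P`, each of at most `4` points, whose
convex hulls all contain `q`. -/
theorem tverberg_approx_dim3 (n : ℕ)
    (P : Finset (EuclideanSpace ℝ (Fin 3))) (hP : P.card = n) :
    ∃ (q : EuclideanSpace ℝ (Fin 3)) (Q : Fin (n / 6) → Finset (EuclideanSpace ℝ (Fin 3))),
      (∀ i, Q i ⊆ P) ∧
      (∀ i, (Q i).card ≤ 4) ∧
      (∀ i j, i ≠ j → Disjoint (Q i) (Q j)) ∧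
      ∀ i, q ∈ convexHull ℝ (Q i : Set (EuclideanSpace ℝ (Fin 3))) := by
  obtain hr | ⟨k, hr⟩ : n / 6 = 0 ∨ ∃ k, n / 6 = k + 1 := by
    rcases h : n / 6 with _ | k
    · exact Or.inl rfl
    · exact Or.inr ⟨k, rfl⟩
  · rw [hr]
    exact ⟨0, finZeroElim, finZeroElim, finZeroElim, finZeroElim, finZeroElim⟩
  rw [hr]
  obtain ⟨q, c, hq⟩ := tverberg_partition (ι := P) (d := 3) (k := k)
    (by rw [Fintype.card_coe]; omega) Subtype.val
  have hex : ∀ j, ∃ t : Finset (EuclideanSpace ℝ (Fin 3)),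
      (t : Set (EuclideanSpace ℝ (Fin 3))) ⊆ Subtype.val '' {i : P | c i = j} ∧ t.card ≤ 4 ∧
        q ∈ convexHull ℝ (t : Set (EuclideanSpace ℝ (Fin 3))) := by
    intro j
    have h := hq j
    rw [convexHull_eq_union] at h
    simp only [Set.mem_iUnion] at h
    obtain ⟨t, hts, hind, hqt⟩ := h
    refine ⟨t, hts, ?_, hqt⟩
    have h1 := hind.card_le_finrank_succ
    have h2 := Submodule.finrank_le
      (vectorSpan ℝ (Set.range ((↑) : t → EuclideanSpace ℝ (Fin 3))))
    simp only [finrank_euclideanSpace, Fintype.card_fin, Fintype.card_coe] at h1 h2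
    omega
  choose T hT hcard hqT using hex
  refine ⟨q, fun i => T (finSuccEquiv k i), fun i p hp => ?_, fun i => hcard _, fun i j hij => ?_,
    fun i => hqT _⟩
  · obtain ⟨p', _, rfl⟩ := hT _ hp
    exact p'.2
  · rw [Finset.disjoint_left]
    intro p hpi hpj
    obtain ⟨p₁, h₁, rfl⟩ := hT _ hpi
    obtain ⟨p₂, h₂, he⟩ := hT _ hpj
    obtain rfl := Subtype.val_injective he
    exact hij ((finSuccEquiv k).injective (h₁.symm.trans h₂))
end

section
/- Let P be a set of n points in ℝ⁴. Then there exist a point q ∈ ℝ⁴ and ⌊n/9⌋ pairwise disjoint subsets of P, each of size at most 5, such that the convex hull of each subset contains q. -/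
section InnerProduct

variable {E : Type*} [NormedAddCommGroup E] [InnerProductSpace ℝ E]

/-- A norm-minimizing point `z` of a convex set `K` satisfies `‖z‖ ^ 2 ≤ ⟪z, y⟫` for `y ∈ K`. -/
theorem Convex.norm_sq_le_inner_of_isMinOn {K : Set E} (hK : Convex ℝ K) {z : E} (hz : z ∈ K)
    (hmin : IsMinOn norm K z) {y : E} (hy : y ∈ K) : ‖z‖ ^ 2 ≤ inner ℝ z y := by
  have hinf : ‖(0 : E) - z‖ = ⨅ w : K, ‖(0 : E) - w‖ := by
    have : Nonempty K := ⟨⟨z, hz⟩⟩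
    refine le_antisymm (le_ciInf fun w => ?_) ?_
    · simpa using hmin w.2
    · exact ciInf_le ⟨0, by rintro _ ⟨w, rfl⟩; exact norm_nonneg _⟩ (⟨z, hz⟩ : K)
  have h := (norm_eq_iInf_iff_real_inner_le_zero hK hz).1 hinf y hy
  rw [zero_sub, inner_neg_left, inner_sub_right, real_inner_self_eq_norm_sq] at h
  linarith

/-- Affinely independent vectors on a hyperplane missing the origin are linearly independent. -/
theorem AffineIndependent.linearIndependent_of_inner_eq_s15 {ι : Type*} {v : ι → E}
    (hv : AffineIndependent ℝ v) {z : E} {a : ℝ} (ha : a ≠ 0) (h : ∀ i, inner ℝ z (v i) = a) :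
    LinearIndependent ℝ v := by
  rw [linearIndependent_iff']
  intro s g hg
  refine hv.eq_zero_of_sum_eq_zero ?_ hg
  have := congrArg (inner ℝ z) hg
  simp only [inner_sum, inner_smul_right, h, inner_zero_right, ← Finset.sum_mul] at this
  exact (mul_eq_zero.1 this).resolve_right ha

/-- **Bárány's colorful Carathéodory theorem.** -/
theorem colorful_caratheodory [FiniteDimensional ℝ E] {ι κ : Type*} [Fintype ι] [Finite κ]
    (hcard : Module.finrank ℝ E < Fintype.card ι) (x : ι → κ → E)
    (hx : ∀ i, 0 ∈ convexHull ℝ (Set.range (x i))) :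
    ∃ f : ι → κ, 0 ∈ convexHull ℝ (Set.range fun i => x i (f i)) := by
  classical
  have hι : Nonempty ι := Fintype.card_pos_iff.1 (by omega)
  have hκ : Nonempty κ := by
    have : (Set.range (x hι.some)).Nonempty := convexHull_nonempty_iff.1 ⟨0, hx hι.some⟩
    exact Set.range_nonempty_iff_nonempty.1 this
  let H : (ι → κ) → Set E := fun f => convexHull ℝ (Set.range fun i => x i (f i))
  have hcompact : IsCompact (⋃ f, H f) :=
    isCompact_iUnion fun f => (Set.finite_range _).isCompact_convexHull ℝ
  have hnonempty : (⋃ f, H f).Nonempty :=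
    Set.nonempty_iUnion.2
      ⟨fun _ => hκ.some, convexHull_nonempty_iff.2 (Set.range_nonempty _)⟩
  obtain ⟨z, hz, hmin⟩ := hcompact.exists_isMinOn hnonempty continuous_norm.continuousOn
  obtain ⟨f, hf⟩ := Set.mem_iUnion.1 hz
  have key : ∀ g, z ∈ H g → ∀ y ∈ H g, ‖z‖ ^ 2 ≤ inner ℝ z y := fun g hg y hy =>
    (convex_convexHull ℝ _).norm_sq_le_inner_of_isMinOn hg
      (hmin.on_subset (Set.subset_iUnion H g)) hy
  by_cases hz0 : z = 0
  · exact ⟨f, hz0 ▸ hf⟩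
  exfalso
  have hpos : 0 < ‖z‖ ^ 2 := by positivity
  obtain ⟨τ, _, v, w, hv, hvind, hw, hw1, hwz⟩ := eq_pos_convex_span_of_mem_convexHull hf
  have hge : ∀ t, ‖z‖ ^ 2 ≤ inner ℝ z (v t) := fun t =>
    key f hf _ (subset_convexHull ℝ _ (hv ⟨t, rfl⟩))
  have hsum : ∑ t, w t * (inner ℝ z (v t) - ‖z‖ ^ 2) = 0 := by
    have := congrArg (inner ℝ z) hwz
    simp only [inner_sum, inner_smul_right, real_inner_self_eq_norm_sq] at this
    simp only [mul_sub, Finset.sum_sub_distrib, ← Finset.sum_mul, this, hw1]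
    ring
  have heq : ∀ t, inner ℝ z (v t) = ‖z‖ ^ 2 := fun t => by
    have := (Finset.sum_eq_zero_iff_of_nonneg fun t _ =>
      mul_nonneg (hw t).le (sub_nonneg.2 (hge t))).1 hsum t (Finset.mem_univ t)
    exact sub_eq_zero.1 ((mul_eq_zero.1 this).resolve_left (hw t).ne')
  have hτ : Fintype.card τ < Fintype.card ι :=
    (hvind.linearIndependent_of_inner_eq_s15 hpos.ne' heq).fintype_card_le_finrank.trans_lt hcard
  choose e he using fun t => hv ⟨t, rfl⟩
  obtain ⟨j, hj⟩ : ∃ j, ∀ t, e t ≠ j := by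
    by_contra! hsurj
    exact hτ.not_ge (Fintype.card_le_of_surjective e hsurj)
  obtain ⟨k, hk⟩ : ∃ k, inner ℝ z (x j k) ≤ 0 := by
    by_contra! hk
    have hconv : Convex ℝ {y | 0 < inner ℝ z y} :=
      convex_halfSpace_gt (innerₗ E z).isLinear 0
    have hsub : convexHull ℝ (Set.range (x j)) ⊆ {y | 0 < inner ℝ z y} :=
      convexHull_min (by rintro _ ⟨k, rfl⟩; exact hk k) hconv
    simpa using hsub (hx j)
  have hg : z ∈ H (Function.update f j k) := by
    refine mem_convexHull_of_exists_fintype w v (fun t => (hw t).le) hw1 (fun t => ?_) hwz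
    exact ⟨e t, by simpa [Function.update_of_ne (hj t)] using he t⟩
  have := key _ hg (x j k) (subset_convexHull ℝ _ ⟨j, by simp⟩)
  linarith

/-- **Tverberg's theorem**, for indexed families: more than `(dim E + 1) * m` points can be
partitioned into `m + 1` classes whose convex hulls have a common point. -/
theorem exists_tverberg_partition [FiniteDimensional ℝ E] {ι : Type*} [Fintype ι] (m : ℕ)
    (p : ι → E) (hcard : (Module.finrank ℝ E + 1) * m < Fintype.card ι) :
    ∃ (c : ι → Option (Fin m)) (q : E), ∀ k, q ∈ convexHull ℝ (p '' (c ⁻¹' {k})) := by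
  classical
  let a : Option (Fin m) → Fin m → ℝ := fun o k =>
    (if o = some k then 1 else 0) - (if o = none then 1 else 0)
  let x : ι → Option (Fin m) → PiLp 2 (fun _ : Fin m => WithLp 2 (E × ℝ)) := fun i o =>
    WithLp.toLp 2 fun k => a o k • WithLp.toLp 2 (p i, 1)
  have hfinrank : Module.finrank ℝ (PiLp 2 (fun _ : Fin m => WithLp 2 (E × ℝ))) =
      (Module.finrank ℝ E + 1) * m := by
    rw [(WithLp.linearEquiv 2 ℝ _).finrank_eq, Module.finrank_pi_fintype]
    simp [(WithLp.linearEquiv 2 ℝ (E × ℝ)).finrank_eq, mul_comm]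
  have hx : ∀ i, 0 ∈ convexHull ℝ (Set.range (x i)) := fun i => by
    refine mem_convexHull_of_exists_fintype (fun _ => ((m : ℝ) + 1)⁻¹) (x i)
      (fun _ => by positivity) ?_ (fun o => ⟨o, rfl⟩) ?_
    · simp only [Finset.sum_const, Finset.card_univ, Fintype.card_option, Fintype.card_fin,
        nsmul_eq_mul, Nat.cast_add, Nat.cast_one]
      exact mul_inv_cancel₀ (by positivity)
    · rw [← Finset.smul_sum]
      convert smul_zero _
      ext1 k
      simp only [x, WithLp.ofLp_sum, Finset.sum_apply, ← Finset.sum_smul]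
      simp [a]
  obtain ⟨c, hc⟩ := colorful_caratheodory (hfinrank ▸ hcard) x hx
  obtain ⟨w, hw, hw1, hw0⟩ : ∃ w : ι → ℝ, (∀ i, 0 ≤ w i) ∧ ∑ i, w i = 1 ∧
      ∑ i, w i • x i (c i) = 0 := by
    rw [convexHull_range_eq_exists_affineCombination] at hc
    obtain ⟨s, w, hw, hw1, hw0⟩ := hc
    rw [s.affineCombination_eq_linear_combination _ _ hw1] at hw0
    refine ⟨fun i => if i ∈ s then w i else 0, fun i => ?_, ?_, ?_⟩
    · dsimp only
      split_ifs with h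
      exacts [hw i h, le_rfl]
    · simpa using hw1
    · simpa [ite_smul] using hw0
  let b : Option (Fin m) → ℝ := fun o => ∑ i with c i = o, w i
  let u : Option (Fin m) → E := fun o => ∑ i with c i = o, w i • p i
  have hbu : ∀ k, WithLp.toLp 2 (u (some k), b (some k)) = WithLp.toLp 2 (u none, b none) := by
    intro k
    have := congrFun (congrArg WithLp.ofLp hw0) k
    simp only [x, a, WithLp.ofLp_sum, WithLp.ofLp_smul, Finset.sum_apply, Pi.smul_apply,
      sub_smul, smul_sub, Finset.sum_sub_distrib, ite_smul, one_smul, zero_smul, smul_ite,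
      smul_zero, ← Finset.sum_filter, WithLp.ofLp_zero, Pi.zero_apply, sub_eq_zero] at this
    have hrw : ∀ o, ∑ i with c i = o, w i • (WithLp.toLp 2 (p i, (1 : ℝ)) : WithLp 2 (E × ℝ)) =
        WithLp.toLp 2 (u o, b o) := fun o => by
      simp only [← WithLp.toLp_smul, ← WithLp.toLp_sum, Prod.smul_mk, smul_eq_mul, mul_one, u, b]
      congr 1
      exact Prod.ext Prod.fst_sum Prod.snd_sum
    rwa [hrw, hrw] at this
  have hb : ∀ o, b o = b none := by
    rintro (_ | k)
    exacts [rfl, congrArg (fun y => (WithLp.ofLp y).2) (hbu k)]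
  have hu : ∀ o, u o = u none := by
    rintro (_ | k)
    exacts [rfl, congrArg (fun y => (WithLp.ofLp y).1) (hbu k)]
  have hbpos : 0 < b none := by
    have hsum : ∑ o, b o = 1 := by rw [← hw1]; exact Finset.sum_fiberwise _ _ _
    simp only [hb, Finset.sum_const, nsmul_eq_mul] at hsum
    exact pos_of_mul_pos_right (hsum ▸ one_pos) (Nat.cast_nonneg _)
  refine ⟨c, (b none)⁻¹ • u none, fun k => ?_⟩
  rw [← hb k, ← hu k]
  exact Finset.centerMass_mem_convexHull _ (fun i _ => hw i) (by rw [← hb k] at hbpos; exact hbpos)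
    fun i hi => ⟨i, by simpa using hi, rfl⟩

/-- **Carathéodory's theorem** with the explicit bound `dim E + 1` on the number of points. -/
theorem exists_finset_card_le_finrank_add_one_of_mem_convexHull [FiniteDimensional ℝ E]
    {s : Set E} {q : E} (hq : q ∈ convexHull ℝ s) :
    ∃ t : Finset E, ↑t ⊆ s ∧ t.card ≤ Module.finrank ℝ E + 1 ∧ q ∈ convexHull ℝ (t : Set E) := by
  rw [convexHull_eq_union] at hq
  simp only [Set.mem_iUnion, exists_prop] at hq
  obtain ⟨t, hts, ht, hqt⟩ := hq
  refine ⟨t, hts, ?_, hqt⟩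
  have := ht.card_le_finrank_succ
  rw [Fintype.card_coe] at this
  exact this.trans (Nat.succ_le_succ (Submodule.finrank_le _))

end InnerProduct


/-- **Tverberg approximation in `ℝ⁴`.** For any set `P` of `n` points in `ℝ⁴`, there are a
point `q` and `⌊n/9⌋` pairwise disjoint subsets of `P`, each of at most `5` points, whose
convex hulls all contain `q`. -/
theorem tverberg_approx_dim4 (n : ℕ)
    (P : Finset (EuclideanSpace ℝ (Fin 4))) (hP : P.card = n) :
    ∃ (q : EuclideanSpace ℝ (Fin 4)) (Q : Fin (n / 9) → Finset (EuclideanSpace ℝ (Fin 4))),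
      (∀ i, Q i ⊆ P) ∧
      (∀ i, (Q i).card ≤ 5) ∧
      (∀ i j, i ≠ j → Disjoint (Q i) (Q j)) ∧
      ∀ i, q ∈ convexHull ℝ (Q i : Set (EuclideanSpace ℝ (Fin 4))) := by
  rcases hm : n / 9 with _ | m
  · exact ⟨0, fun _ => ∅, fun i => i.elim0, fun i => i.elim0, fun i => i.elim0, fun i => i.elim0⟩
  obtain ⟨c, q, hq⟩ := exists_tverberg_partition m (fun i : P => (i : EuclideanSpace ℝ (Fin 4)))
    (by rw [finrank_euclideanSpace_fin, Fintype.card_coe]; omega)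
  choose Q hQs hQc hQ using fun k =>
    exists_finset_card_le_finrank_add_one_of_mem_convexHull (hq k)
  have e : Fin (m + 1) ≃ Option (Fin m) := finSuccEquiv m
  refine ⟨q, fun i => Q (e i), fun i y hy => ?_, fun i => ?_, fun i j hij => ?_, fun i => hQ _⟩
  · obtain ⟨y, -, rfl⟩ := hQs _ hy
    exact y.2
  · simpa using hQc (e i)
  · refine Finset.disjoint_left.2 fun y hyi hyj => hij (e.injective ?_)
    obtain ⟨a, ha, rfl⟩ := hQs _ hyi
    obtain ⟨b, hb, hab⟩ := hQs _ hyj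
    obtain rfl := Subtype.ext hab
    exact ha.symm.trans hb
end
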